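/- (Edigarian–Zwonek) Let f : G_d → G_d be a holomorphic map of the symmetrized polydisc. Then f is proper if and only if there exists a finite Blaschke product B such that f(s(z₁,…,z_d)) = s(B(z₁),…,B(z_d)) for all (z₁,…,z_d) ∈ 𝔻^d. Moreover, f is a biholomorphism of G_d onto itself if and only if there exists a holomorphic bijection φ : 𝔻 → 𝔻 such that f(s(z₁,…,z_d)) = s(φ(z₁),…,φ(z_d)) for all (z₁,…,z_d) ∈ 𝔻^d. -/

import Mathlib

open Metric Set Complex

noncomputable section

/-- The unit polydisc `𝔻^d` in `ℂ^d`. -/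
def polydisc (d : ℕ) : Set (Fin d → ℂ) := {z | ∀ i, z i ∈ ball (0 : ℂ) 1}

/-- The symmetrization map `s : ℂ^d → ℂ^d` (elementary symmetric polynomials). -/
def symmMap (d : ℕ) (z : Fin d → ℂ) : Fin d → ℂ :=
  fun i => ∑ t ∈ Finset.univ.powersetCard ((i : ℕ) + 1), ∏ j ∈ t, z j

/-- The symmetrized polydisc `G_d = s(𝔻^d)`. -/
def symPolydisc (d : ℕ) : Set (Fin d → ℂ) := symmMap d '' polydisc d

section SymmetrizedPolydisc

open Polynomial Filter Topology

lemma mem_polydisc {d : ℕ} {z : Fin d → ℂ} : z ∈ polydisc d ↔ ∀ i, ‖z i‖ < 1 := by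
  simp [polydisc]

lemma polydisc_eq_ball (d : ℕ) : polydisc d = ball 0 1 := by
  ext z
  simp [mem_polydisc, pi_norm_lt_iff]

lemma isOpen_polydisc (d : ℕ) : IsOpen (polydisc d) := by
  rw [polydisc_eq_ball]
  exact isOpen_ball

lemma continuous_symmMap (d : ℕ) : Continuous (symmMap d) := by
  unfold symmMap
  fun_prop

lemma differentiable_symmMap (d : ℕ) : Differentiable ℂ (symmMap d) := by
  unfold symmMap
  fun_prop

/-- The homogeneous form `∏ (u - zᵢ v)`, written in terms of `w = s(z)`. -/
def homForm {A : Type*} [CommRing A] [Algebra ℂ A] {d : ℕ} (w : Fin d → ℂ) (u v : A) : A :=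
  u ^ d + ∑ k : Fin d, algebraMap ℂ A (w k) * ((-1) ^ ((k : ℕ) + 1) * v ^ ((k : ℕ) + 1) *
    u ^ (d - (k + 1)))

lemma homForm_symmMap {A : Type*} [CommRing A] [Algebra ℂ A] {d : ℕ} (z : Fin d → ℂ) (u v : A) :
    homForm (symmMap d z) u v = ∏ i, (u - algebraMap ℂ A (z i) * v) := by
  have h : ∀ i, u - algebraMap ℂ A (z i) * v = -(algebraMap ℂ A (z i) * v) + u := fun i => by ring
  simp_rw [h]
  rw [Finset.prod_add, Finset.sum_powerset, Finset.card_univ, Fintype.card_fin,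
    Finset.sum_range_succ', homForm, add_comm]
  congr 1
  · rw [← Fin.sum_univ_eq_sum_range
      (fun k => ∑ t ∈ Finset.powersetCard (k + 1) (Finset.univ : Finset (Fin d)),
        (∏ i ∈ t, -(algebraMap ℂ A (z i) * v)) * ∏ i ∈ Finset.univ \ t, u) d]
    refine Finset.sum_congr rfl fun k _ => ?_
    rw [symmMap, map_sum, Finset.sum_mul]
    refine Finset.sum_congr rfl fun t ht => ?_
    rw [Finset.mem_powersetCard] at ht
    rw [Finset.prod_const, Finset.card_sdiff_of_subset ht.1, Finset.card_univ, Fintype.card_fin,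
      ht.2, Finset.prod_neg, Finset.prod_mul_distrib, Finset.prod_const, ht.2, map_prod]
    ring
  · simp

/-- The monic polynomial whose roots are the points `zᵢ` with `s(z) = w`. -/
def rootPoly {d : ℕ} (w : Fin d → ℂ) : ℂ[X] := homForm w X 1

lemma rootPoly_symmMap {d : ℕ} (z : Fin d → ℂ) :
    rootPoly (symmMap d z) = ∏ i, (X - C (z i)) := by
  simp [rootPoly, homForm_symmMap]

lemma coeff_rootPoly {d : ℕ} (w : Fin d → ℂ) (n : ℕ) :
    (rootPoly w).coeff n = (X ^ d : ℂ[X]).coeff n +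
      ∑ k : Fin d, w k * ((-1) ^ ((k : ℕ) + 1) * (X ^ (d - (k + 1)) : ℂ[X]).coeff n) := by
  simp only [rootPoly, homForm, coeff_add, finsetSum_coeff, Polynomial.algebraMap_apply,
    Algebra.algebraMap_self, RingHom.id_apply, coeff_C_mul, one_pow, mul_one]
  congr 1
  refine Finset.sum_congr rfl fun k _ => ?_
  congr 1
  rw [show ((-1 : ℂ[X]) ^ ((k : ℕ) + 1)) = C ((-1) ^ ((k : ℕ) + 1)) by simp, coeff_C_mul]

lemma coeff_rootPoly_sub {d : ℕ} (w : Fin d → ℂ) (k : Fin d) :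
    (rootPoly w).coeff (d - (k + 1)) = w k * (-1) ^ ((k : ℕ) + 1) := by
  have hk := k.2
  rw [coeff_rootPoly, coeff_X_pow, if_neg (by omega), zero_add,
    Finset.sum_eq_single k]
  · simp
  · intro j _ hj
    have hj2 := j.2
    rw [coeff_X_pow, if_neg, mul_zero, mul_zero]
    intro h
    exact hj (Fin.ext (by omega))
  · simp

lemma rootPoly_injective (d : ℕ) : Function.Injective (rootPoly (d := d)) := by
  intro w w' h
  ext k
  have := coeff_rootPoly_sub w k
  rw [h, coeff_rootPoly_sub w' k] at this
  exact (mul_right_cancel₀ (pow_ne_zero _ (by norm_num)) this).symm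

lemma symmMap_eq_iff {d : ℕ} {z z' : Fin d → ℂ} :
    symmMap d z = symmMap d z' ↔ ∏ i, (X - C (z i)) = ∏ i, (X - C (z' i)) := by
  rw [← rootPoly_symmMap, ← rootPoly_symmMap, (rootPoly_injective d).eq_iff]

lemma isRoot_prod_X_sub_C {d : ℕ} {z : Fin d → ℂ} {β : ℂ} :
    (∏ i, (X - C (z i))).IsRoot β ↔ ∃ i, z i = β := by
  simp [IsRoot.def, eval_prod, Finset.prod_eq_zero_iff, sub_eq_zero, @eq_comm _ β]

lemma exists_eq_of_symmMap_eq {d : ℕ} {z z' : Fin d → ℂ} (h : symmMap d z = symmMap d z')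
    (i : Fin d) : ∃ j, z' j = z i := by
  rw [← isRoot_prod_X_sub_C, ← symmMap_eq_iff.1 h, isRoot_prod_X_sub_C]
  exact ⟨i, rfl⟩

lemma mem_polydisc_of_symmMap {d : ℕ} {z : Fin d → ℂ} (h : symmMap d z ∈ symPolydisc d) :
    z ∈ polydisc d := by
  obtain ⟨z', hz', h⟩ := h
  refine mem_polydisc.2 fun i => ?_
  obtain ⟨j, hj⟩ := exists_eq_of_symmMap_eq h.symm i
  rw [← hj]
  exact mem_polydisc.1 hz' j

lemma symmMap_comp_perm {d : ℕ} (z : Fin d → ℂ) (σ : Equiv.Perm (Fin d)) :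
    symmMap d (z ∘ σ) = symmMap d z := by
  rw [symmMap_eq_iff]
  exact Equiv.prod_comp σ fun i => (X - C (z i))

lemma isCompact_closedPolydisc_inter {d : ℕ} (K : Set (Fin d → ℂ)) (hK : IsCompact K) (r : ℝ) :
    IsCompact {z : Fin d → ℂ | (∀ i, ‖z i‖ ≤ r) ∧ symmMap d z ∈ K} := by
  convert (isCompact_univ_pi fun _ : Fin d => isCompact_closedBall (0 : ℂ) r).inter_right
    (hK.isClosed.preimage (continuous_symmMap d)) using 1
  ext z
  simp [Set.mem_pi]

lemma exists_radius_of_isCompact {d : ℕ} {K : Set (Fin d → ℂ)} (hK : IsCompact K)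
    (hKG : K ⊆ symPolydisc d) :
    ∃ ρ : ℝ, 0 ≤ ρ ∧ ρ < 1 ∧ ∀ z, symmMap d z ∈ K → ∀ i, ‖z i‖ ≤ ρ := by
  set T := {z : Fin d → ℂ | (∀ i, ‖z i‖ ≤ 1) ∧ symmMap d z ∈ K} with hT
  have hTc : IsCompact T := isCompact_closedPolydisc_inter K hK 1
  have hmem : ∀ z, symmMap d z ∈ K → z ∈ T ∧ ‖z‖ < 1 := by
    intro z hz
    have h := mem_polydisc_of_symmMap (hKG hz)
    exact ⟨⟨fun i => (mem_polydisc.1 h i).le, hz⟩, by simpa [polydisc_eq_ball] using h⟩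
  rcases T.eq_empty_or_nonempty with h0 | hne
  · exact ⟨0, le_rfl, one_pos, fun z hz => absurd (hmem z hz).1 (by simp [h0])⟩
  · obtain ⟨z₀, hz₀, hmax⟩ := hTc.exists_isMaxOn hne continuous_norm.continuousOn
    exact ⟨‖z₀‖, norm_nonneg _, (hmem z₀ hz₀.2).2, fun z hz i =>
      (norm_le_pi_norm z i).trans (hmax (hmem z hz).1)⟩

lemma isCompact_symmMap_closedPolydisc (d : ℕ) (r : ℝ) :
    IsCompact (symmMap d '' {z | ∀ i, ‖z i‖ ≤ r}) := by
  refine IsCompact.image ?_ (continuous_symmMap d)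
  convert isCompact_univ_pi fun _ : Fin d => isCompact_closedBall (0 : ℂ) r using 1
  ext z
  simp [Set.mem_pi]

section AnalyticTools

variable {E : Type*} [NormedAddCommGroup E] [NormedSpace ℂ E]

lemma eq_zero_of_eventuallyEq_zero_ball {g : E → ℂ} (hg : DifferentiableOn ℂ g (ball 0 1))
    {p : E} (hp : p ∈ ball (0 : E) 1) (h0 : g =ᶠ[𝓝 p] 0) : ∀ q ∈ ball (0 : E) 1, g q = 0 := by
  intro q hq
  let γ : ℂ → E := fun t => p + t • (q - p)
  have hγ : Differentiable ℂ γ := by fun_prop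
  let U : Set ℂ := γ ⁻¹' ball 0 1
  have hUo : IsOpen U := isOpen_ball.preimage hγ.continuous
  have hUc : IsPreconnected U := by
    refine Convex.isPreconnected ?_
    rw [convex_iff_forall_pos]
    intro x hx y hy a b ha hb hab
    have := (convex_ball (0 : E) 1) (mem_preimage.1 hx) (mem_preimage.1 hy) ha.le hb.le hab
    have e : a • γ x + b • γ y = γ (a • x + b • y) := by
      simp only [γ, smul_add, add_smul, smul_assoc]
      rw [add_add_add_comm, ← add_smul, hab, one_smul]
    rwa [e] at this
  have hd : DifferentiableOn ℂ (g ∘ γ) U := hg.comp hγ.differentiableOn (mapsTo_preimage _ _)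
  have h0U : (0 : ℂ) ∈ U := by simpa [U, γ] using hp
  have h1U : (1 : ℂ) ∈ U := by simpa [U, γ] using hq
  have hev : (g ∘ γ) =ᶠ[𝓝 0] 0 := by
    have ht : Tendsto γ (𝓝 0) (𝓝 p) := by
      have := hγ.continuous.tendsto 0
      simpa [γ] using this
    exact ht.eventually h0
  have := (hd.analyticOnNhd hUo).eqOn_zero_of_preconnected_of_eventuallyEq_zero hUc h0U hev h1U
  simpa [γ] using this

lemma differentiableOn_finset_prod {ι : Type*} (s : Finset ι) {g : ι → E → ℂ} {U : Set E}
    (hg : ∀ i ∈ s, DifferentiableOn ℂ (g i) U) :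
    DifferentiableOn ℂ (fun w => ∏ i ∈ s, g i w) U := by
  classical
  induction s using Finset.induction_on with
  | empty => simp
  | insert a s ha ih =>
    simp only [Finset.prod_insert ha]
    exact (hg a (by simp)).mul (ih fun i hi => hg i (by simp [hi]))

lemma differentiableOn_quotient {g h : E → ℂ} {U : Set E} (hg : DifferentiableOn ℂ g U)
    (hh : DifferentiableOn ℂ h U) (h0 : ∀ w ∈ U, h w ≠ 0) :
    DifferentiableOn ℂ (fun w => g w / h w) U := by
  simp only [div_eq_mul_inv]
  exact hg.mul (hh.inv h0)

lemma exists_eq_zero_of_prod_eq_zero {ι : Type*} (s : Finset ι) {g : ι → E → ℂ}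
    (hg : ∀ i ∈ s, DifferentiableOn ℂ (g i) (ball 0 1))
    (h : ∀ w ∈ ball (0 : E) 1, ∏ i ∈ s, g i w = 0) :
    ∃ i ∈ s, ∀ w ∈ ball (0 : E) 1, g i w = 0 := by
  classical
  induction s using Finset.induction_on with
  | empty => simpa using h 0 (by simp)
  | insert a s ha ih =>
    by_cases h0 : ∀ w ∈ ball (0 : E) 1, g a w = 0
    · exact ⟨a, by simp, h0⟩
    push Not at h0
    obtain ⟨p, hp, hp0⟩ := h0
    have hs : ∀ w ∈ ball (0 : E) 1, ∏ i ∈ s, g i w = 0 := by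
      have hgs : DifferentiableOn ℂ (fun w => ∏ i ∈ s, g i w) (ball 0 1) :=
        differentiableOn_finset_prod s fun i hi => hg i (by simp [hi])
      refine eq_zero_of_eventuallyEq_zero_ball hgs hp ?_
      have hc : ContinuousAt (g a) p :=
        (hg a (by simp)).continuousOn.continuousAt (isOpen_ball.mem_nhds hp)
      filter_upwards [hc.eventually_ne hp0, isOpen_ball.mem_nhds hp] with w hw hwb
      have := h w hwb
      rw [Finset.prod_insert ha] at this
      simpa [hw] using this
    obtain ⟨i, hi, hi'⟩ := ih (fun i hi => hg i (by simp [hi])) hs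
    exact ⟨i, by simp [hi], hi'⟩

/-- A form of Harnack's inequality, for holomorphic functions with positive real part. -/
lemma norm_zero_le_of_re_pos {h : E → ℂ} (hd : DifferentiableOn ℂ h (ball 0 1))
    (hpos : ∀ w ∈ ball (0 : E) 1, 0 < (h w).re) {w : E} (hw : w ∈ ball (0 : E) 1) :
    (1 - ‖w‖) * ‖h 0‖ ≤ (1 + ‖w‖) * ‖h w‖ := by
  have h0 : 0 < (h 0).re := hpos 0 (by simp)
  have hne : ∀ w ∈ ball (0 : E) 1, h w + (starRingEnd ℂ) (h 0) ≠ 0 := by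
    intro w hw h'
    have := congrArg Complex.re h'
    have := hpos w hw
    simp at *
    linarith
  let k : E → ℂ := fun w => (h w - h 0) / (h w + (starRingEnd ℂ) (h 0))
  have hk : DifferentiableOn ℂ k (ball 0 1) :=
    differentiableOn_quotient (hd.sub_const _) (hd.add_const _) hne
  have hlt : ∀ w ∈ ball (0 : E) 1, ‖h w - h 0‖ ≤ ‖h w + (starRingEnd ℂ) (h 0)‖ := by
    intro w hw
    have := hpos w hw
    refine (sq_le_sq₀ (norm_nonneg _) (norm_nonneg _)).1 ?_
    rw [← Complex.normSq_eq_norm_sq, ← Complex.normSq_eq_norm_sq, Complex.normSq_apply,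
      Complex.normSq_apply]
    simp
    nlinarith
  have hkm : MapsTo k (ball 0 1) (closedBall 0 1) := by
    intro w hw
    rw [mem_closedBall_zero_iff, norm_div]
    exact div_le_one_of_le₀ (hlt w hw) (norm_nonneg _)
  have := norm_le_norm_of_mapsTo_ball hk hkm (by simp [k]) (by simpa using hw)
  rw [norm_div, div_le_iff₀ (norm_pos_iff.2 (hne w hw))] at this
  have h1 : ‖h 0‖ - ‖h w‖ ≤ ‖h w - h 0‖ := by
    rw [← norm_neg (h w - h 0), neg_sub]
    exact norm_sub_norm_le _ _
  have h2 : ‖h w + (starRingEnd ℂ) (h 0)‖ ≤ ‖h w‖ + ‖h 0‖ := by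
    refine (norm_add_le _ _).trans ?_
    simp
  nlinarith [norm_nonneg w]

end AnalyticTools

lemma norm_le_of_boundary_norm_le {h : ℂ → ℂ} (hd : DifferentiableOn ℂ h (ball 0 1)) {M : ℝ}
    (hM : ∀ ε > 0, ∃ ρ < 1, ∀ z ∈ ball (0 : ℂ) 1, ρ < ‖z‖ → ‖h z‖ ≤ M + ε) :
    ∀ z ∈ ball (0 : ℂ) 1, ‖h z‖ ≤ M := by
  intro z hz
  refine le_of_forall_pos_le_add fun ε hε => ?_
  obtain ⟨ρ, hρ, hb⟩ := hM ε hε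
  rw [mem_ball_zero_iff] at hz
  obtain ⟨R, hR, hR1⟩ := exists_between (max_lt hρ hz)
  rw [max_lt_iff] at hR
  have hsub : closedBall (0 : ℂ) R ⊆ ball 0 1 := closedBall_subset_ball hR1
  refine norm_le_of_forall_mem_frontier_norm_le (U := ball (0 : ℂ) R) isBounded_ball
    (DifferentiableOn.diffContOnCl ?_) (fun w hw => ?_) (subset_closure (by simpa using hR.2))
  · exact hd.mono (closure_ball_subset_closedBall.trans hsub)
  · have hw' : w ∈ sphere (0 : ℂ) R := frontier_ball_subset_sphere hw
    exact hb w (hsub (sphere_subset_closedBall hw')) (by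
      rw [mem_sphere_zero_iff_norm] at hw'
      rw [hw']
      exact hR.1)

section CayleySum

lemma re_cayley_pos {b β : ℂ} (hb : ‖b‖ = 1) (hβ : ‖β‖ < 1) : 0 < ((b + β) / (b - β)).re := by
  have hne : b - β ≠ 0 := by
    rw [sub_ne_zero]
    rintro rfl
    linarith
  have h1 : ((b + β) / (b - β)).re = (‖b‖ ^ 2 - ‖β‖ ^ 2) / Complex.normSq (b - β) := by
    rw [Complex.div_re, ← Complex.normSq_eq_norm_sq, ← Complex.normSq_eq_norm_sq, ← add_div]
    simp only [Complex.normSq_apply, add_re, sub_re, add_im, sub_im]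
    ring
  rw [h1]
  refine div_pos ?_ (Complex.normSq_pos.2 hne)
  rw [hb]
  nlinarith [norm_nonneg β]

variable {p : ℂ[X]} {n : ℕ} {b : ℂ}

lemma eval_ne_zero_of_roots_mem_ball (hroots : ∀ β, p.IsRoot β → ‖β‖ < 1) (hb : ‖b‖ = 1) :
    p.eval b ≠ 0 := fun h => by
  have := hroots b h
  linarith

lemma cayley_sum_eq (hdeg : p.natDegree = n) (hroots : ∀ β, p.IsRoot β → ‖β‖ < 1)
    (hb : ‖b‖ = 1) :
    2 * b * (p.derivative.eval b / p.eval b) - n =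
      (p.roots.map fun β => (b + β) / (b - β)).sum := by
  have hsp : p.Splits := IsAlgClosed.splits p
  rw [hsp.eval_derivative_div_eval_of_ne_zero (eval_ne_zero_of_roots_mem_ball hroots hb),
    ← Multiset.sum_map_mul_left, ← hdeg, splits_iff_card_roots.1 hsp |>.symm]
  have : ((Multiset.card p.roots : ℕ) : ℂ) = (p.roots.map fun _ => (1 : ℂ)).sum := by simp
  rw [this, ← Multiset.sum_map_sub]
  congr 1
  refine Multiset.map_congr rfl fun β hβ => ?_
  have hβ := hroots β (isRoot_of_mem_roots hβ)
  have hne : b - β ≠ 0 := by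
    rw [sub_ne_zero]
    rintro rfl
    linarith
  field_simp
  ring

lemma re_cayley_sum_ge (hdeg : p.natDegree = n) (hroots : ∀ β, p.IsRoot β → ‖β‖ < 1)
    (hb : ‖b‖ = 1) {β : ℂ} (hβ : β ∈ p.roots) :
    ((b + β) / (b - β)).re ≤ (2 * b * (p.derivative.eval b / p.eval b) - n).re := by
  rw [cayley_sum_eq hdeg hroots hb]
  change _ ≤ Complex.reAddGroupHom _
  rw [map_multiset_sum, Multiset.map_map]
  refine Multiset.single_le_sum (fun x hx => ?_) _ (Multiset.mem_map.2 ⟨β, hβ, rfl⟩)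
  obtain ⟨γ, hγ, rfl⟩ := Multiset.mem_map.1 hx
  exact (re_cayley_pos hb (hroots γ (isRoot_of_mem_roots hγ))).le

lemma norm_cayley_sum_le (hdeg : p.natDegree = n) (hroots : ∀ β, p.IsRoot β → ‖β‖ < 1)
    (hb : ‖b‖ = 1) {δ : ℝ} (hδ : 0 < δ) (hfar : ∀ β, p.IsRoot β → δ ≤ ‖b - β‖) :
    ‖2 * b * (p.derivative.eval b / p.eval b) - n‖ ≤ n * (2 / δ) := by
  rw [cayley_sum_eq hdeg hroots hb]
  refine (norm_multiset_sum_le _).trans ?_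
  rw [Multiset.map_map]
  refine (Multiset.sum_le_card_nsmul _ (2 / δ) fun x hx => ?_).trans ?_
  · obtain ⟨γ, hγ, rfl⟩ := Multiset.mem_map.1 hx
    have hγ := isRoot_of_mem_roots hγ
    have h1 := hfar γ hγ
    have h2 := hroots γ hγ
    simp only [Function.comp_apply, norm_div]
    gcongr
    refine (norm_add_le _ _).trans ?_
    linarith
  · rw [Multiset.card_map, nsmul_eq_mul]
    gcongr
    rw [← hdeg]
    exact p.card_roots'

end CayleySum

/-- A holomorphic family, over the polydisc, of monic polynomials of degree `n` with all roots in
the unit disc, symmetric in the parameters, and such that some root tends to the unit circle when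
the parameter tends to the boundary of the polydisc. -/
structure ProperRootFamily (d n : ℕ) (Q : (Fin d → ℂ) → ℂ[X]) : Prop where
  monic : ∀ z ∈ polydisc d, (Q z).Monic
  natDegree : ∀ z ∈ polydisc d, (Q z).natDegree = n
  diff : ∀ k, DifferentiableOn ℂ (fun z => (Q z).coeff k) (polydisc d)
  roots : ∀ z ∈ polydisc d, ∀ β, (Q z).IsRoot β → ‖β‖ < 1
  symm : ∀ z ∈ polydisc d, ∀ σ : Equiv.Perm (Fin d), Q (z ∘ σ) = Q z
  proper : ∀ r < 1, ∃ ρ < 1, ∀ z ∈ polydisc d, (∃ i, ρ < ‖z i‖) →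
    ∃ β, (Q z).IsRoot β ∧ r < ‖β‖

lemma update_mem_polydisc {d : ℕ} {w : Fin d → ℂ} (hw : w ∈ polydisc d) (i₀ : Fin d) {ζ : ℂ}
    (hζ : ‖ζ‖ < 1) : Function.update w i₀ ζ ∈ polydisc d := by
  rw [mem_polydisc] at *
  intro i
  rcases eq_or_ne i i₀ with rfl | h
  · simpa
  · simpa [h] using hw i

lemma differentiable_update_left {d : ℕ} (i₀ : Fin d) (ζ : ℂ) :
    Differentiable ℂ fun w : Fin d → ℂ => Function.update w i₀ ζ := by
  rw [differentiable_pi]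
  intro i
  rcases eq_or_ne i i₀ with rfl | h
  · simp
  · simp only [Function.update_of_ne h]
    fun_prop

lemma differentiable_update_right {d : ℕ} (w : Fin d → ℂ) (i₀ : Fin d) :
    Differentiable ℂ fun ζ : ℂ => Function.update w i₀ ζ := by
  rw [differentiable_pi]
  intro i
  rcases eq_or_ne i i₀ with rfl | h
  · simp
  · simp only [Function.update_of_ne h]
    fun_prop

lemma zero_mem_polydisc (d : ℕ) : (0 : Fin d → ℂ) ∈ polydisc d := by
  simp [mem_polydisc]

namespace ProperRootFamily

variable {d n : ℕ} {Q : (Fin d → ℂ) → ℂ[X]}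

lemma differentiableOn_eval (hQ : ProperRootFamily d n Q) (x : ℂ) :
    DifferentiableOn ℂ (fun z => (Q z).eval x) (polydisc d) := by
  have h : DifferentiableOn ℂ (fun z => ∑ k ∈ Finset.range (n + 1), (Q z).coeff k * x ^ k)
      (polydisc d) := DifferentiableOn.fun_sum fun k _ => (hQ.diff k).mul_const _
  refine h.congr fun z hz => ?_
  exact eval_eq_sum_range' (by rw [hQ.natDegree z hz]; omega) x

lemma differentiableOn_eval_derivative (hQ : ProperRootFamily d n Q) (x : ℂ) :
    DifferentiableOn ℂ (fun z => (Q z).derivative.eval x) (polydisc d) := by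
  have h : DifferentiableOn ℂ
      (fun z => ∑ k ∈ Finset.range (n + 1), (Q z).derivative.coeff k * x ^ k) (polydisc d) := by
    refine DifferentiableOn.fun_sum fun k _ => ?_
    simp only [coeff_derivative]
    exact ((hQ.diff _).mul_const _).mul_const _
  refine h.congr fun z hz => ?_
  refine eval_eq_sum_range' ?_ x
  have := natDegree_derivative_le (Q z)
  rw [hQ.natDegree z hz] at this
  omega

lemma mem_roots (hQ : ProperRootFamily d n Q) {z : Fin d → ℂ} (hz : z ∈ polydisc d) {β : ℂ} :
    β ∈ (Q z).roots ↔ (Q z).IsRoot β :=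
  Polynomial.mem_roots (hQ.monic z hz).ne_zero

lemma exists_close_roots (hQ : ProperRootFamily d n Q) (i₀ : Fin d) {w : Fin d → ℂ}
    (hw : w ∈ polydisc d) {ε : ℝ} (hε : 0 < ε) :
    ∃ ρ < 1, ∀ ζ ∈ ball (0 : ℂ) 1, ρ < ‖ζ‖ →
      ∃ β β', (Q (Function.update 0 i₀ ζ)).IsRoot β ∧ (Q (Function.update w i₀ ζ)).IsRoot β' ∧
        ‖β - β'‖ < ε := by
  have hs : ‖w‖ < 1 := by simpa [polydisc_eq_ball] using hw
  have hc0 : 0 < (1 - ‖w‖) * (ε / 2) / (4 * n + 4) := by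
    have : 0 < 1 - ‖w‖ := by linarith
    positivity
  obtain ⟨c, hcpos, hc⟩ := exists_between (lt_min (lt_min (half_pos hε) one_pos) hc0)
  rw [lt_min_iff, lt_min_iff] at hc
  obtain ⟨⟨hc1, hc2⟩, hc3⟩ := hc
  obtain ⟨ρ, hρ, hρ'⟩ := hQ.proper (1 - c) (by linarith)
  refine ⟨ρ, hρ, fun ζ hζ hρζ => ?_⟩
  rw [mem_ball_zero_iff] at hζ
  have hmem : ∀ w ∈ polydisc d, Function.update w i₀ ζ ∈ polydisc d :=
    fun w hw => update_mem_polydisc hw i₀ hζ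
  have hz0 := hmem 0 (zero_mem_polydisc d)
  obtain ⟨β, hβ, hβr⟩ := hρ' _ hz0 ⟨i₀, by simpa using hρζ⟩
  have hβ1 := hQ.roots _ hz0 β hβ
  have hβpos : 0 < ‖β‖ := by linarith
  set b : ℂ := β / (‖β‖ : ℂ) with hbdef
  have hβc : (‖β‖ : ℂ) ≠ 0 := by exact_mod_cast hβpos.ne'
  have hb : ‖b‖ = 1 := by
    rw [hbdef, norm_div, Complex.norm_real, norm_norm, div_self hβpos.ne']
  have hββ : β = (‖β‖ : ℂ) * b := by
    rw [hbdef]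
    field_simp
  have hbβ : ‖b - β‖ = 1 - ‖β‖ := by
    have : b - β = ((1 - ‖β‖ : ℝ) : ℂ) * b := by
      conv_lhs => rw [hββ]
      push_cast
      ring
    rw [this, norm_mul, hb, mul_one, Complex.norm_real, Real.norm_of_nonneg (by linarith)]
  suffices h : ∃ β', (Q (Function.update w i₀ ζ)).IsRoot β' ∧ ‖b - β'‖ < ε / 2 by
    obtain ⟨β', h1, h2⟩ := h
    refine ⟨β, β', hβ, h1, ?_⟩
    calc ‖β - β'‖ = ‖(b - β') - (b - β)‖ := by congr 1; ring
      _ ≤ ‖b - β'‖ + ‖b - β‖ := norm_sub_le _ _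
      _ < ε := by rw [hbβ]; linarith
  by_contra! hfar
  let h : (Fin d → ℂ) → ℂ := fun v =>
    2 * b * ((Q (Function.update v i₀ ζ)).derivative.eval b / (Q (Function.update v i₀ ζ)).eval b)
      - n
  have hd : DifferentiableOn ℂ h (ball 0 1) := by
    rw [← polydisc_eq_ball]
    refine DifferentiableOn.sub_const (DifferentiableOn.const_mul
      (differentiableOn_quotient ?_ ?_ fun v hv => ?_) _) _
    · exact (hQ.differentiableOn_eval_derivative b).comp
        (differentiable_update_left i₀ ζ).differentiableOn hmem
    · exact (hQ.differentiableOn_eval b).comp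
        (differentiable_update_left i₀ ζ).differentiableOn hmem
    · exact eval_ne_zero_of_roots_mem_ball (hQ.roots _ (hmem v hv)) hb
  have hn : 0 < n := by
    rw [← hQ.natDegree _ hz0]
    exact (Multiset.card_pos_iff_exists_mem.2 ⟨β, (hQ.mem_roots hz0).2 hβ⟩).trans_le (card_roots' _)
  have hpos : ∀ v ∈ ball (0 : Fin d → ℂ) 1, 0 < (h v).re := by
    intro v hv
    rw [← polydisc_eq_ball] at hv
    have hv' := hmem v hv
    obtain ⟨γ, hγ⟩ : ∃ γ, γ ∈ (Q (Function.update v i₀ ζ)).roots := by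
      rw [← Multiset.card_pos_iff_exists_mem,
        splits_iff_card_roots.1 (IsAlgClosed.splits _), hQ.natDegree _ hv']
      exact hn
    refine lt_of_lt_of_le (re_cayley_pos hb (hQ.roots _ hv' γ ((hQ.mem_roots hv').1 hγ))) ?_
    exact re_cayley_sum_ge (hQ.natDegree _ hv') (hQ.roots _ hv') hb hγ
  have hharnack := norm_zero_le_of_re_pos hd hpos (by simpa using hs : w ∈ ball 0 1)
  have h1 : ‖h w‖ ≤ n * (2 / (ε / 2)) :=
    norm_cayley_sum_le (hQ.natDegree _ (hmem w hw)) (hQ.roots _ (hmem w hw)) hb (by linarith)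
      hfar
  have h2 : c⁻¹ ≤ ‖h 0‖ := by
    refine le_trans ?_ (Complex.re_le_norm _)
    refine le_trans ?_ (re_cayley_sum_ge (hQ.natDegree _ hz0) (hQ.roots _ hz0) hb
      ((hQ.mem_roots hz0).2 hβ))
    have hb0 : b ≠ 0 := by
      rintro h0
      simp [h0] at hb
    have hne : (1 - (‖β‖ : ℂ)) ≠ 0 := by
      have : (1 - ‖β‖ : ℝ) ≠ 0 := by linarith
      exact_mod_cast this
    have e : (b + β) / (b - β) = (((1 + ‖β‖) / (1 - ‖β‖) : ℝ) : ℂ) := by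
      have e₁ : b + β = (1 + (‖β‖ : ℂ)) * b := by
        conv_lhs => rw [hββ]
        ring
      have e₂ : b - β = (1 - (‖β‖ : ℂ)) * b := by
        conv_lhs => rw [hββ]
        ring
      rw [e₁, e₂]
      push_cast
      rw [mul_div_mul_right _ _ hb0]
    rw [e, Complex.ofReal_re, inv_eq_one_div]
    exact div_le_div₀ (by linarith) (by linarith) (by linarith) (by linarith)
  have hw0 := norm_nonneg w
  have h3 : (1 - ‖w‖) * c⁻¹ ≤ 2 * (n * (2 / (ε / 2))) := by
    refine (mul_le_mul_of_nonneg_left h2 (by linarith)).trans (hharnack.trans ?_)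
    refine mul_le_mul (by linarith) h1 (norm_nonneg _) (by norm_num)
  rw [lt_div_iff₀ (by positivity)] at hc3
  have h4 : (1 - ‖w‖) * (ε / 2) ≤ 4 * n * c := by
    rw [← div_eq_mul_inv, div_le_iff₀ hcpos] at h3
    calc (1 - ‖w‖) * (ε / 2) ≤ 2 * (n * (2 / (ε / 2))) * c * (ε / 2) := by gcongr
      _ = 4 * n * c := by field_simp; ring
  nlinarith

end ProperRootFamily

lemma norm_multiset_prod_le_of_mem {s : Multiset ℂ} {M ε : ℝ} (hM : 1 ≤ M)
    (hs : ∀ x ∈ s, ‖x‖ ≤ M) {x : ℂ} (hx : x ∈ s) (hxε : ‖x‖ ≤ ε) :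
    ‖s.prod‖ ≤ ε * M ^ Multiset.card s := by
  have hε : 0 ≤ ε := (norm_nonneg x).trans hxε
  obtain ⟨t, rfl⟩ := Multiset.exists_cons_of_mem hx
  have ht : ∀ t : Multiset ℂ, (∀ x ∈ t, ‖x‖ ≤ M) → ‖t.prod‖ ≤ M ^ Multiset.card t := by
    intro t
    induction t using Multiset.induction_on with
    | empty => simp
    | cons a t ih =>
      intro h
      rw [Multiset.prod_cons, norm_mul, Multiset.card_cons, pow_succ']
      exact mul_le_mul (h a (by simp)) (ih fun x hx => h x (by simp [hx])) (norm_nonneg _)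
        (by linarith)
  rw [Multiset.prod_cons, norm_mul, Multiset.card_cons]
  refine mul_le_mul hxε ((ht t fun x hx => hs x (by simp [hx])).trans ?_) (norm_nonneg _) hε
  exact pow_le_pow_right₀ hM (by omega)

namespace ProperRootFamily

variable {d n : ℕ} {Q : (Fin d → ℂ) → ℂ[X]}

lemma differentiableOn_resultant (hQ : ProperRootFamily d n Q) (i₀ : Fin d) {w w' : Fin d → ℂ}
    (hw : w ∈ polydisc d) (hw' : w' ∈ polydisc d) :
    DifferentiableOn ℂ (fun ζ => resultant (Q (Function.update w i₀ ζ))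
      (Q (Function.update w' i₀ ζ)) n n) (ball 0 1) := by
  have hcoeff : ∀ w ∈ polydisc d, ∀ k,
      DifferentiableOn ℂ (fun ζ => (Q (Function.update w i₀ ζ)).coeff k) (ball 0 1) := by
    intro w hw k
    exact (hQ.diff k).comp (differentiable_update_right w i₀).differentiableOn
      fun ζ hζ => update_mem_polydisc hw i₀ (by simpa using hζ)
  simp only [resultant, Matrix.det_apply]
  refine DifferentiableOn.fun_sum fun σ _ => DifferentiableOn.const_smul
    (differentiableOn_finset_prod _ fun i _ => ?_) _
  simp only [sylvester, Matrix.of_apply]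
  induction i using Fin.addCases with
  | left j =>
    simp only [Fin.addCases_left]
    split_ifs
    · exact hcoeff w' hw' _
    · exact differentiableOn_const 0
  | right j =>
    simp only [Fin.addCases_right]
    split_ifs
    · exact hcoeff w hw _
    · exact differentiableOn_const 0

lemma exists_common_root_zero (hQ : ProperRootFamily d n Q) (i₀ : Fin d) {w : Fin d → ℂ}
    (hw : w ∈ polydisc d) {ζ : ℂ} (hζ : ζ ∈ ball (0 : ℂ) 1) :
    ∃ β, (Q (Function.update 0 i₀ ζ)).IsRoot β ∧ (Q (Function.update w i₀ ζ)).IsRoot β := by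
  have hmem : ∀ w ∈ polydisc d, ∀ ζ ∈ ball (0 : ℂ) 1, Function.update w i₀ ζ ∈ polydisc d :=
    fun w hw ζ hζ => update_mem_polydisc hw i₀ (by simpa using hζ)
  have h0 := zero_mem_polydisc d
  have hprod : ∀ ζ ∈ ball (0 : ℂ) 1, resultant (Q (Function.update 0 i₀ ζ))
      (Q (Function.update w i₀ ζ)) n n = (((Q (Function.update 0 i₀ ζ)).roots ×ˢ
      (Q (Function.update w i₀ ζ)).roots).map fun ij => ij.1 - ij.2).prod := by
    intro ζ hζ
    rw [← resultant_eq_prod_roots_sub _ _ (hQ.monic _ (hmem 0 h0 ζ hζ))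
      (hQ.monic _ (hmem w hw ζ hζ)) (IsAlgClosed.splits _) (IsAlgClosed.splits _),
      hQ.natDegree _ (hmem 0 h0 ζ hζ), hQ.natDegree _ (hmem w hw ζ hζ)]
  have hzero : ‖resultant (Q (Function.update 0 i₀ ζ)) (Q (Function.update w i₀ ζ)) n n‖ ≤ 0 := by
    refine norm_le_of_boundary_norm_le (hQ.differentiableOn_resultant i₀ h0 hw)
      (fun ε hε => ?_) ζ hζ
    obtain ⟨ρ, hρ, H⟩ := hQ.exists_close_roots i₀ hw
      (show 0 < ε / 2 ^ (n * n) by positivity)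
    refine ⟨ρ, hρ, fun ζ hζ hρζ => ?_⟩
    obtain ⟨β, β', hβ, hβ', hlt⟩ := H ζ hζ hρζ
    have hz0 := hmem 0 h0 ζ hζ
    have hzw := hmem w hw ζ hζ
    rw [hprod ζ hζ]
    refine (norm_multiset_prod_le_of_mem (M := 2) (ε := ε / 2 ^ (n * n)) (by norm_num)
      (fun x hx => ?_) (x := β - β') ?_ hlt.le).trans ?_
    · obtain ⟨⟨a, b⟩, hab, rfl⟩ := Multiset.mem_map.1 hx
      rw [Multiset.mem_product, hQ.mem_roots hz0, hQ.mem_roots hzw] at hab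
      have h1 := hQ.roots _ hz0 a hab.1
      have h2 := hQ.roots _ hzw b hab.2
      exact (norm_sub_le _ _).trans (by dsimp only; linarith)
    · exact Multiset.mem_map.2 ⟨(β, β'), by
        rw [Multiset.mem_product, hQ.mem_roots hz0, hQ.mem_roots hzw]
        exact ⟨hβ, hβ'⟩, rfl⟩
    · rw [Multiset.card_map, Multiset.card_product,
        splits_iff_card_roots.1 (IsAlgClosed.splits _),
        splits_iff_card_roots.1 (IsAlgClosed.splits _), hQ.natDegree _ hz0, hQ.natDegree _ hzw]
      field_simp
      simp
  rw [norm_le_zero_iff, hprod ζ hζ, Multiset.prod_eq_zero_iff, Multiset.mem_map] at hzero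
  obtain ⟨⟨a, b⟩, hab, h⟩ := hzero
  rw [Multiset.mem_product, hQ.mem_roots (hmem 0 h0 ζ hζ), hQ.mem_roots (hmem w hw ζ hζ)] at hab
  have : a = b := sub_eq_zero.1 h
  subst this
  exact ⟨a, hab⟩

/-- The polynomials of the family over a slice `{z | z i₀ = ζ}` have a common root. -/
lemma exists_common_root (hQ : ProperRootFamily d n Q) (i₀ : Fin d) {ζ : ℂ}
    (hζ : ζ ∈ ball (0 : ℂ) 1) :
    ∃ β, ∀ z ∈ polydisc d, z i₀ = ζ → (Q z).IsRoot β := by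
  have hmem : ∀ w ∈ polydisc d, Function.update w i₀ ζ ∈ polydisc d :=
    fun w hw => update_mem_polydisc hw i₀ (by simpa using hζ)
  obtain ⟨β, -, hβ⟩ := exists_eq_zero_of_prod_eq_zero
    (Q (Function.update 0 i₀ ζ)).roots.toFinset
    (g := fun β w => (Q (Function.update w i₀ ζ)).eval β)
    (fun β _ => by
      rw [← polydisc_eq_ball]
      exact (hQ.differentiableOn_eval β).comp
        (differentiable_update_left i₀ ζ).differentiableOn hmem)
    (fun w hw => by
      rw [← polydisc_eq_ball] at hw
      obtain ⟨β, h1, h2⟩ := hQ.exists_common_root_zero i₀ hw hζ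
      exact Finset.prod_eq_zero (i := β)
        (by simpa using (hQ.mem_roots (hmem 0 (zero_mem_polydisc d))).2 h1) h2)
  refine ⟨β, fun z hz hzζ => ?_⟩
  rw [← polydisc_eq_ball] at hβ
  have := hβ z hz
  rwa [← hzζ, Function.update_eq_self] at this

/-- If no point is a root of all the polynomials of the family, one can choose a value of a
parameter so that the common roots over the corresponding slice avoid a given finite set. -/
lemma exists_slice_avoiding (hQ : ProperRootFamily d n Q) (i₀ : Fin d)
    (hconst : ∀ β, ∃ z ∈ polydisc d, (Q z).eval β ≠ 0) (T : Finset ℂ) :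
    ∃ ζ ∈ ball (0 : ℂ) 1, ∀ β ∈ T, ∃ z ∈ polydisc d, z i₀ = ζ ∧ (Q z).eval β ≠ 0 := by
  choose w hw hwne using hconst
  have hmem : ∀ β, ∀ ζ ∈ ball (0 : ℂ) 1, Function.update (w β) i₀ ζ ∈ polydisc d :=
    fun β ζ hζ => update_mem_polydisc (hw β) i₀ (by simpa using hζ)
  by_contra! hcon
  obtain ⟨β, -, hβ⟩ := exists_eq_zero_of_prod_eq_zero T
    (g := fun β ζ => (Q (Function.update (w β) i₀ ζ)).eval β)
    (fun β _ => (hQ.differentiableOn_eval β).comp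
        (differentiable_update_right (w β) i₀).differentiableOn (hmem β))
    (fun ζ hζ => by
      obtain ⟨β, hβ, h⟩ := hcon ζ hζ
      exact Finset.prod_eq_zero hβ (h _ (hmem β ζ hζ) (by simp)))
  refine hwne β ?_
  have := hβ (w β i₀) (by simpa using mem_polydisc.1 (hw β) i₀)
  rwa [Function.update_eq_self] at this

end ProperRootFamily

lemma exists_injective_parameters {c : ℂ → ℂ} (hinf : (c '' ball (0 : ℂ) 1).Infinite) (d : ℕ)
    (T : Finset ℂ) :
    ∃ z ∈ polydisc d, Function.Injective (fun i => c (z i)) ∧ ∀ i, c (z i) ∉ T := by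
  let e := (hinf.sdiff T.finite_toSet).natEmbedding
  have he : ∀ k, ∃ ζ ∈ ball (0 : ℂ) 1, c ζ = e k := fun k => (e k).2.1
  choose ζ hζ hcζ using he
  refine ⟨fun i => ζ i, fun i => hζ i, fun i j hij => ?_, fun i => ?_⟩
  · simp only [hcζ] at hij
    exact Fin.ext (e.injective (Subtype.ext hij))
  · rw [hcζ]
    exact (e i).2.2

lemma prod_X_sub_C_dvd_of_injective {ι : Type*} [Fintype ι] {p : ℂ[X]} {b : ι → ℂ}
    (hb : Function.Injective b) (hroot : ∀ i, p.IsRoot (b i)) : ∏ i, (X - C (b i)) ∣ p :=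
  Finset.prod_dvd_of_coprime (fun _ _ _ _ hij => pairwise_coprime_X_sub_C hb hij)
    fun i _ => dvd_iff_isRoot.2 (hroot i)

namespace ProperRootFamily

variable {d n : ℕ} {Q : (Fin d → ℂ) → ℂ[X]}

lemma exists_selection (hQ : ProperRootFamily d n Q) (i₀ : Fin d) :
    ∃ c : ℂ → ℂ, ∀ z ∈ polydisc d, ∀ i, (Q z).IsRoot (c (z i)) := by
  have h : ∀ ζ : ℂ, ∃ β, ζ ∈ ball (0 : ℂ) 1 → ∀ z ∈ polydisc d, z i₀ = ζ → (Q z).IsRoot β := by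
    intro ζ
    by_cases hζ : ζ ∈ ball (0 : ℂ) 1
    · obtain ⟨β, hβ⟩ := hQ.exists_common_root i₀ hζ
      exact ⟨β, fun _ => hβ⟩
    · exact ⟨0, fun h => absurd h hζ⟩
  choose c hc using h
  refine ⟨c, fun z hz i => ?_⟩
  rw [← hQ.symm z hz (Equiv.swap i₀ i)]
  refine hc (z i) (hz i) _ (fun j => hz _) ?_
  simp

lemma infinite_selection (hQ : ProperRootFamily d n Q) (i₀ : Fin d)
    (hconst : ∀ β, ∃ z ∈ polydisc d, (Q z).eval β ≠ 0) {c : ℂ → ℂ}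
    (hc : ∀ z ∈ polydisc d, ∀ i, (Q z).IsRoot (c (z i))) : (c '' ball (0 : ℂ) 1).Infinite := by
  intro hfin
  obtain ⟨ζ, hζ, h⟩ := hQ.exists_slice_avoiding i₀ hconst hfin.toFinset
  obtain ⟨z, hz, hzζ, hne⟩ := h (c ζ) (by simpa using ⟨ζ, by simpa using hζ, rfl⟩)
  exact hne (by simpa [hzζ] using hc z hz i₀)

lemma divByMonic (hQ : ProperRootFamily d (n + 1) Q) {β : ℂ}
    (hβ : ∀ z ∈ polydisc d, (Q z).IsRoot β) :
    ProperRootFamily d n fun z => Q z /ₘ (X - C β) := by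
  have hmul : ∀ z ∈ polydisc d, (X - C β) * (Q z /ₘ (X - C β)) = Q z :=
    fun z hz => mul_divByMonic_eq_iff_isRoot.2 (hβ z hz)
  refine ⟨fun z hz => ?_, fun z hz => ?_, fun k => ?_, fun z hz γ hγ => ?_, fun z hz σ => ?_,
    fun r hr => ?_⟩
  · have h := hQ.monic z hz
    rw [← hmul z hz] at h
    exact (monic_X_sub_C β).of_mul_monic_left h
  · rw [natDegree_divByMonic _ (monic_X_sub_C β), hQ.natDegree z hz, natDegree_X_sub_C]
    rfl
  · have h : DifferentiableOn ℂ (fun z => ∑ i ∈ Finset.Icc (k + 1) (n + 1),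
        β ^ (i - (k + 1)) * (Q z).coeff i) (polydisc d) :=
      DifferentiableOn.fun_sum fun i _ => (hQ.diff i).const_mul _
    refine h.congr fun z hz => ?_
    rw [coeff_divByMonic_X_sub_C, hQ.natDegree z hz]
  · refine hQ.roots z hz γ ?_
    rw [← hmul z hz, IsRoot.def, eval_mul, hγ, mul_zero]
  · simp only [hQ.symm z hz σ]
  · have h1 : ‖β‖ < 1 := hQ.roots 0 (zero_mem_polydisc d) β (hβ 0 (zero_mem_polydisc d))
    obtain ⟨ρ, hρ, h⟩ := hQ.proper (max r ‖β‖) (max_lt hr h1)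
    refine ⟨ρ, hρ, fun z hz hi => ?_⟩
    obtain ⟨γ, hγ, hlt⟩ := h z hz hi
    rw [max_lt_iff] at hlt
    refine ⟨γ, ?_, hlt.1⟩
    rw [← hmul z hz, IsRoot.def, eval_mul, mul_eq_zero] at hγ
    refine hγ.resolve_left fun h => ?_
    rw [eval_sub, eval_X, eval_C, sub_eq_zero] at h
    exact hlt.2.ne (by rw [h])

lemma le_degree (i₀ : Fin d) (hQ : ProperRootFamily d n Q) : d ≤ n := by
  induction n generalizing Q with
  | zero =>
    obtain ⟨β, hβ⟩ := hQ.exists_common_root i₀ (ζ := 0) (by simp)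
    have h0 := zero_mem_polydisc d
    have h := eq_one_of_monic_natDegree_zero (hQ.monic 0 h0) (hQ.natDegree 0 h0)
    have := hβ 0 h0 rfl
    simp [h] at this
  | succ n ih =>
    by_cases hconst : ∀ β, ∃ z ∈ polydisc d, (Q z).eval β ≠ 0
    · obtain ⟨c, hc⟩ := hQ.exists_selection i₀
      obtain ⟨z, hz, hinj, -⟩ :=
        exists_injective_parameters (hQ.infinite_selection i₀ hconst hc) d ∅
      have := natDegree_le_of_dvd (prod_X_sub_C_dvd_of_injective hinj (hc z hz))
        (hQ.monic z hz).ne_zero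
      rw [hQ.natDegree z hz] at this
      simpa using this
    · push Not at hconst
      obtain ⟨β, hβ⟩ := hconst
      have := ih (hQ.divByMonic hβ)
      omega

lemma exists_eval_ne_zero (i₀ : Fin d) (hQ : ProperRootFamily d d Q) (β : ℂ) :
    ∃ z ∈ polydisc d, (Q z).eval β ≠ 0 := by
  by_contra! hcon
  obtain ⟨n, rfl⟩ : ∃ n, d = n + 1 := ⟨d - 1, by have := i₀.2; omega⟩
  have := (hQ.divByMonic hcon).le_degree i₀
  omega

lemma eq_prod_of_injective (hQ : ProperRootFamily d d Q) {z : Fin d → ℂ} (hz : z ∈ polydisc d)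
    {b : Fin d → ℂ} (hb : Function.Injective b) (hroot : ∀ i, (Q z).IsRoot (b i)) :
    Q z = ∏ i, (X - C (b i)) := by
  refine eq_of_monic_of_dvd_of_natDegree_le (monic_prod_X_sub_C b Finset.univ) (hQ.monic z hz)
    (prod_X_sub_C_dvd_of_injective hb hroot) ?_
  rw [hQ.natDegree z hz]
  simp

lemma injective_update {c : ℂ → ℂ} {z : Fin d → ℂ} {i₀ : Fin d} {ζ : ℂ}
    (hinj : Function.Injective fun i => c (z i)) (hζ : ∀ i, i ≠ i₀ → c ζ ≠ c (z i)) :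
    Function.Injective fun i => c (Function.update z i₀ ζ i) := by
  intro i j hij
  by_cases hi : i = i₀ <;> by_cases hj : j = i₀
  · rw [hi, hj]
  · subst hi
    simp only [Function.update_self, Function.update_of_ne hj] at hij
    exact absurd hij (hζ j hj)
  · subst hj
    simp only [Function.update_self, Function.update_of_ne hi] at hij
    exact absurd hij.symm (hζ i hi)
  · simp only [Function.update_of_ne hi, Function.update_of_ne hj] at hij
    exact hinj hij

lemma selection_unique (hQ : ProperRootFamily d d Q) (i₀ : Fin d) {c : ℂ → ℂ}
    (hc : ∀ z ∈ polydisc d, ∀ i, (Q z).IsRoot (c (z i))) {ζ β : ℂ} (hζ : ζ ∈ ball (0 : ℂ) 1)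
    (hβ : ∀ z ∈ polydisc d, z i₀ = ζ → (Q z).IsRoot β) : β = c ζ := by
  obtain ⟨z, hz, hinj, hT⟩ := exists_injective_parameters
    (hQ.infinite_selection i₀ (hQ.exists_eval_ne_zero i₀) hc) d {β, c ζ}
  simp only [Finset.mem_insert, Finset.mem_singleton, not_or] at hT
  have hz' : Function.update z i₀ ζ ∈ polydisc d := update_mem_polydisc hz i₀ (by simpa using hζ)
  have h := hβ _ hz' (by simp)
  rw [hQ.eq_prod_of_injective hz' (injective_update hinj fun i _ h => (hT i).2 h.symm)
    (hc _ hz'), isRoot_prod_X_sub_C] at h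
  obtain ⟨i, hi⟩ := h
  by_cases hii : i = i₀
  · subst hii
    simpa using hi.symm
  · rw [Function.update_of_ne hii] at hi
    exact absurd hi (hT i).1

lemma selection_differentiableOn (hQ : ProperRootFamily d d Q) (i₀ : Fin d) {c : ℂ → ℂ}
    (hc : ∀ z ∈ polydisc d, ∀ i, (Q z).IsRoot (c (z i))) :
    DifferentiableOn ℂ c (ball 0 1) := by
  intro ζ₀ hζ₀
  obtain ⟨z, hz, hinj, hT⟩ := exists_injective_parameters
    (hQ.infinite_selection i₀ (hQ.exists_eval_ne_zero i₀) hc) d {c ζ₀}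
  simp only [Finset.mem_singleton] at hT
  have hnhds : ball (0 : ℂ) 1 ∈ 𝓝 ζ₀ := isOpen_ball.mem_nhds hζ₀
  have hmem : ∀ w ∈ polydisc d, ∀ ζ ∈ ball (0 : ℂ) 1, Function.update w i₀ ζ ∈ polydisc d :=
    fun w hw ζ hζ => update_mem_polydisc hw i₀ (by simpa using hζ)
  have hd : ∀ w ∈ polydisc d, ∀ x, DifferentiableAt ℂ
      (fun ζ => (Q (Function.update w i₀ ζ)).eval x) ζ₀ := fun w hw x =>
    ((hQ.differentiableOn_eval x).comp (differentiable_update_right w i₀).differentiableOn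
      (hmem w hw)).differentiableAt hnhds
  have hne : ∀ᶠ ζ in 𝓝 ζ₀, ∀ i, c ζ ≠ c (z i) := by
    rw [eventually_all]
    intro i
    have : ∃ w ∈ polydisc d, w i₀ = ζ₀ ∧ (Q w).eval (c (z i)) ≠ 0 := by
      by_contra! hcon
      exact hT i (hQ.selection_unique i₀ hc hζ₀ hcon)
    obtain ⟨w, hw, hwζ, hne⟩ := this
    have hcont := (hd w hw (c (z i))).continuousAt
    filter_upwards [hcont.eventually_ne (y := 0) (by rwa [← hwζ, Function.update_eq_self]),
      hnhds] with ζ h1 h2 h3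
    refine h1 ?_
    have := hc _ (hmem w hw ζ h2) i₀
    rwa [Function.update_self, h3] at this
  set D : ℂ := ∏ i ∈ Finset.univ.erase i₀, (1 - c (z i)) with hD
  have hD0 : D ≠ 0 := by
    refine Finset.prod_ne_zero_iff.2 fun i _ => ?_
    rw [sub_ne_zero]
    intro h
    have := hQ.roots z hz _ (hc z hz i)
    rw [← h] at this
    simp at this
  have hev : c =ᶠ[𝓝 ζ₀] fun ζ => 1 - (Q (Function.update z i₀ ζ)).eval 1 / D := by
    filter_upwards [hne, hnhds] with ζ h1 h2
    have hz' := hmem z hz ζ h2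
    have hprod : ∏ i ∈ Finset.univ.erase i₀, (1 - c (Function.update z i₀ ζ i)) = D :=
      Finset.prod_congr rfl fun i hi => by rw [Function.update_of_ne (Finset.ne_of_mem_erase hi)]
    rw [hQ.eq_prod_of_injective hz' (injective_update hinj fun i _ => h1 i) (hc _ hz'), eval_prod,
      ← Finset.mul_prod_erase _ _ (Finset.mem_univ i₀)]
    simp only [eval_sub, eval_X, eval_C, Function.update_self]
    rw [hprod]
    field_simp
    ring
  refine DifferentiableAt.differentiableWithinAt ?_
  exact (((hd z hz 1).div_const D).const_sub 1).congr_of_eventuallyEq hev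

/-- A proper root family of degree `d` over the `d`-dimensional polydisc splits. -/
theorem exists_eq_prod (hQ : ProperRootFamily d d Q) (i₀ : Fin d) :
    ∃ c : ℂ → ℂ, DifferentiableOn ℂ c (ball 0 1) ∧ MapsTo c (ball 0 1) (ball 0 1) ∧
      (∀ r < 1, ∃ ρ < 1, ∀ ζ ∈ ball (0 : ℂ) 1, ρ < ‖ζ‖ → r < ‖c ζ‖) ∧
      ∀ z ∈ polydisc d, Q z = ∏ i, (X - C (c (z i))) := by
  obtain ⟨c, hc⟩ := hQ.exists_selection i₀
  have hd := hQ.selection_differentiableOn i₀ hc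
  have hdiag : ∀ ζ ∈ ball (0 : ℂ) 1, Function.update (0 : Fin d → ℂ) i₀ ζ ∈ polydisc d := fun ζ hζ =>
    update_mem_polydisc (zero_mem_polydisc d) i₀ (by simpa using hζ)
  have hmaps : MapsTo c (ball 0 1) (ball 0 1) := by
    intro ζ hζ
    have := hQ.roots _ (hdiag ζ hζ) _ (hc _ (hdiag ζ hζ) i₀)
    simpa using this
  have hprod : ∀ z ∈ polydisc d, Q z = ∏ i, (X - C (c (z i))) := by
    intro z hz
    refine Polynomial.funext fun x => ?_
    have hci : ∀ i, DifferentiableOn ℂ (fun z : Fin d → ℂ => c (z i)) (polydisc d) := fun i =>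
      hd.comp (differentiable_apply i).differentiableOn fun z hz => hz i
    have hg : DifferentiableOn ℂ
        (fun z => (Q z).eval x - ∏ i, (x - c (z i))) (polydisc d) :=
      (hQ.differentiableOn_eval x).sub
        (differentiableOn_finset_prod _ fun i _ => (hci i).const_sub x)
    obtain ⟨z₀, hz₀, hinj, -⟩ := exists_injective_parameters
      (hQ.infinite_selection i₀ (hQ.exists_eval_ne_zero i₀) hc) d ∅
    have hnhds := (isOpen_polydisc d).mem_nhds hz₀
    have hev : ∀ᶠ z in 𝓝 z₀, Function.Injective fun i => c (z i) := by
      have : ∀ᶠ z in 𝓝 z₀, ∀ i j, i ≠ j → c (z i) ≠ c (z j) := by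
        rw [eventually_all]
        intro i
        rw [eventually_all]
        intro j
        by_cases hij : i = j
        · simp [hij]
        have hcont : ∀ i, ContinuousAt (fun z : Fin d → ℂ => c (z i)) z₀ := fun i =>
          (hci i).continuousOn.continuousAt hnhds
        filter_upwards [((hcont i).sub (hcont j)).eventually_ne
          (sub_ne_zero.2 fun h => hij (hinj h))] with z hz _
        exact sub_ne_zero.1 hz
      filter_upwards [this] with z hz i j h
      by_contra hij
      exact hz i j hij h
    rw [polydisc_eq_ball] at hg
    have := eq_zero_of_eventuallyEq_zero_ball hg (polydisc_eq_ball d ▸ hz₀) (by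
      filter_upwards [hev, hnhds] with z h1 h2
      rw [hQ.eq_prod_of_injective h2 h1 (hc z h2), eval_prod]
      simp) z (polydisc_eq_ball d ▸ hz)
    rw [eval_prod]
    simpa [sub_eq_zero] using this
  refine ⟨c, hd, hmaps, fun r hr => ?_, hprod⟩
  have h0 : ‖c 0‖ < 1 := by simpa using hmaps (mem_ball_self one_pos)
  obtain ⟨ρ, hρ, h⟩ := hQ.proper (max r ‖c 0‖) (max_lt hr h0)
  refine ⟨ρ, hρ, fun ζ hζ hρζ => ?_⟩
  obtain ⟨β, hβ, hlt⟩ := h _ (hdiag ζ hζ) ⟨i₀, by simpa using hρζ⟩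
  rw [max_lt_iff] at hlt
  rw [hprod _ (hdiag ζ hζ), isRoot_prod_X_sub_C] at hβ
  obtain ⟨i, hi⟩ := hβ
  by_cases hii : i = i₀
  · subst hii
    rw [Function.update_self] at hi
    rw [hi]
    exact hlt.1
  · rw [Function.update_of_ne hii] at hi
    exact absurd hlt.2 (by simp [← hi])

end ProperRootFamily

section Blaschke

/-- The filter of neighbourhoods of the unit circle inside the unit disc. -/
def discEnd : Filter ℂ := comap norm (𝓝[<] 1)

lemma eventually_discEnd {p : ℂ → Prop} :
    (∀ᶠ z in discEnd, p z) ↔ ∃ ρ < 1, ∀ z ∈ ball (0 : ℂ) 1, ρ < ‖z‖ → p z := by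
  rw [discEnd, ((nhdsLT_basis (1 : ℝ)).comap norm).eventually_iff]
  simp only [mem_preimage, mem_Ioo, mem_ball_zero_iff]
  exact exists_congr fun ρ => and_congr_right fun _ =>
    ⟨fun h z h1 h2 => h ⟨h2, h1⟩, fun h z hz => h z hz.2 hz.1⟩

lemma tendsto_norm_discEnd : Tendsto (norm : ℂ → ℝ) discEnd (𝓝 1) :=
  tendsto_comap.mono_right nhdsWithin_le_nhds

lemma eventually_mem_ball_discEnd : ∀ᶠ z in discEnd, z ∈ ball (0 : ℂ) 1 :=
  eventually_discEnd.2 ⟨0, one_pos, fun _ hz _ => hz⟩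

instance : NeBot discEnd := by
  refine ⟨fun h => ?_⟩
  have : ∀ᶠ _ in discEnd, False := by simp [h]
  obtain ⟨ρ, hρ, h⟩ := eventually_discEnd.1 this
  obtain ⟨r, hr, hr1⟩ := exists_between (max_lt hρ (one_pos (α := ℝ)))
  rw [max_lt_iff] at hr
  refine h (r : ℂ) ?_ ?_ <;> simp [abs_of_pos hr.2, hr1, hr.1]

lemma tendsto_norm_of_forall_lt {b : ℂ → ℂ} (hm : MapsTo b (ball 0 1) (ball 0 1))
    (hb : ∀ r < 1, ∃ ρ < 1, ∀ ζ ∈ ball (0 : ℂ) 1, ρ < ‖ζ‖ → r < ‖b ζ‖) :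
    Tendsto (fun z => ‖b z‖) discEnd (𝓝 1) := by
  refine tendsto_order.2 ⟨fun r hr => eventually_discEnd.2 (hb r hr), fun r hr => ?_⟩
  filter_upwards [eventually_mem_ball_discEnd] with z hz
  exact (mem_ball_zero_iff.1 (hm hz)).trans hr

/-- A holomorphic function on the disc whose modulus is asymptotically at most `1` at the boundary
is bounded by `1`. -/
lemma norm_le_one_of_tendsto {h : ℂ → ℂ} (hd : DifferentiableOn ℂ h (ball 0 1))
    (ht : Tendsto (fun z => ‖h z‖) discEnd (𝓝 1)) : ∀ z ∈ ball (0 : ℂ) 1, ‖h z‖ ≤ 1 :=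
  norm_le_of_boundary_norm_le hd fun _ hε =>
    eventually_discEnd.1 ((ht.eventually_lt_const (lt_add_of_pos_right 1 hε)).mono
      fun _ h => h.le)

/-- The Blaschke factor with zero `a`. -/
def blaschkeFactor (a z : ℂ) : ℂ := (z - a) / (1 - (starRingEnd ℂ) a * z)

lemma one_sub_conj_mul_ne_zero {a z : ℂ} (ha : ‖a‖ < 1) (hz : ‖z‖ ≤ 1) :
    1 - (starRingEnd ℂ) a * z ≠ 0 := by
  intro h
  have : ‖(starRingEnd ℂ) a * z‖ = 1 := by rw [← sub_eq_zero.1 h, norm_one]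
  rw [norm_mul, RCLike.norm_conj] at this
  nlinarith [norm_nonneg a, norm_nonneg z]

lemma one_sub_norm_sq_blaschkeFactor {a z : ℂ} (ha : ‖a‖ < 1) (hz : ‖z‖ ≤ 1) :
    1 - ‖blaschkeFactor a z‖ ^ 2
      = (1 - ‖a‖ ^ 2) * (1 - ‖z‖ ^ 2) / ‖1 - (starRingEnd ℂ) a * z‖ ^ 2 := by
  have h : ‖1 - (starRingEnd ℂ) a * z‖ ^ 2 ≠ 0 :=
    pow_ne_zero _ (norm_ne_zero_iff.2 (one_sub_conj_mul_ne_zero ha hz))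
  rw [blaschkeFactor, norm_div, div_pow, eq_div_iff h, sub_mul, div_mul_cancel₀ _ h]
  simp only [← Complex.normSq_eq_norm_sq, Complex.normSq_apply]
  simp
  ring

lemma norm_blaschkeFactor_lt_one {a z : ℂ} (ha : ‖a‖ < 1) (hz : ‖z‖ < 1) :
    ‖blaschkeFactor a z‖ < 1 := by
  have h := one_sub_norm_sq_blaschkeFactor ha hz.le
  have : 0 < (1 - ‖a‖ ^ 2) * (1 - ‖z‖ ^ 2) / ‖1 - (starRingEnd ℂ) a * z‖ ^ 2 := by
    have h1 := norm_pos_iff.2 (one_sub_conj_mul_ne_zero ha hz.le)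
    have h2 : 0 < 1 - ‖a‖ ^ 2 := by nlinarith [norm_nonneg a]
    have h3 : 0 < 1 - ‖z‖ ^ 2 := by nlinarith [norm_nonneg z]
    positivity
  rw [← h] at this
  nlinarith [norm_nonneg (blaschkeFactor a z)]

lemma norm_sq_blaschkeFactor_le {a z : ℂ} {ρ : ℝ} (ha : ‖a‖ ≤ ρ) (hρ : ρ < 1) (hz : ‖z‖ < 1) :
    ‖blaschkeFactor a z‖ ^ 2 ≤ 1 - (1 - ρ ^ 2) * (1 - ‖z‖ ^ 2) / 4 := by
  have ha1 := ha.trans_lt hρ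
  have h := one_sub_norm_sq_blaschkeFactor ha1 hz.le
  have h1 := norm_pos_iff.2 (one_sub_conj_mul_ne_zero ha1 hz.le)
  have h3 : 0 ≤ 1 - ‖z‖ ^ 2 := by nlinarith [norm_nonneg z]
  have h4 : ‖1 - (starRingEnd ℂ) a * z‖ ≤ 2 := by
    refine (norm_sub_le _ _).trans ?_
    rw [norm_mul, RCLike.norm_conj, norm_one]
    nlinarith [norm_nonneg z, norm_nonneg a]
  have h5 : (1 - ρ ^ 2) * (1 - ‖z‖ ^ 2) / 4
      ≤ (1 - ‖a‖ ^ 2) * (1 - ‖z‖ ^ 2) / ‖1 - (starRingEnd ℂ) a * z‖ ^ 2 := by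
    refine div_le_div₀ ?_ ?_ (by positivity) (by nlinarith)
    · exact mul_nonneg (by nlinarith [norm_nonneg a]) h3
    · exact mul_le_mul_of_nonneg_right (by nlinarith [norm_nonneg a]) h3
  linarith

lemma differentiableOn_blaschkeFactor {a : ℂ} (ha : ‖a‖ < 1) :
    DifferentiableOn ℂ (blaschkeFactor a) (ball 0 1) :=
  differentiableOn_quotient (by fun_prop) (by fun_prop) fun _ hz =>
    one_sub_conj_mul_ne_zero ha (mem_ball_zero_iff.1 hz).le

lemma tendsto_norm_blaschkeFactor {a : ℂ} (ha : ‖a‖ < 1) :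
    Tendsto (fun z => ‖blaschkeFactor a z‖) discEnd (𝓝 1) := by
  have h1 : Tendsto (fun z : ℂ => (1 - ‖a‖ ^ 2) * (1 - ‖z‖ ^ 2) / (1 - ‖a‖) ^ 2) discEnd (𝓝 0) := by
    have := (((tendsto_norm_discEnd.pow 2).const_sub 1).const_mul (1 - ‖a‖ ^ 2)).div_const
      ((1 - ‖a‖) ^ 2)
    simpa using this
  have h2 : Tendsto (fun z => 1 - ‖blaschkeFactor a z‖ ^ 2) discEnd (𝓝 0) := by
    refine tendsto_of_tendsto_of_tendsto_of_le_of_le' tendsto_const_nhds h1 ?_ ?_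
    · filter_upwards [eventually_mem_ball_discEnd] with z hz
      have := norm_blaschkeFactor_lt_one ha (mem_ball_zero_iff.1 hz)
      nlinarith [norm_nonneg (blaschkeFactor a z)]
    · filter_upwards [eventually_mem_ball_discEnd] with z hz
      rw [mem_ball_zero_iff] at hz
      rw [one_sub_norm_sq_blaschkeFactor ha hz.le]
      have h3 : 0 ≤ (1 - ‖a‖ ^ 2) * (1 - ‖z‖ ^ 2) :=
        mul_nonneg (by nlinarith [norm_nonneg a]) (by nlinarith [norm_nonneg z])
      have h4 : 1 - ‖a‖ ≤ ‖1 - (starRingEnd ℂ) a * z‖ := by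
        have := norm_sub_norm_le 1 ((starRingEnd ℂ) a * z)
        rw [norm_mul, RCLike.norm_conj, norm_one] at this
        nlinarith [norm_nonneg z, norm_nonneg a]
      have h5 : 0 < 1 - ‖a‖ := by linarith
      gcongr
  have h3 : Tendsto (fun z => Real.sqrt (1 - (1 - ‖blaschkeFactor a z‖ ^ 2))) discEnd (𝓝 1) := by
    simpa using (h2.const_sub 1).sqrt
  refine h3.congr fun z => ?_
  rw [sub_sub_cancel, Real.sqrt_sq (norm_nonneg _)]

lemma tendsto_norm_prod_blaschkeFactor {m : ℕ} {a : Fin m → ℂ} (ha : ∀ j, ‖a j‖ < 1) :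
    Tendsto (fun z => ‖∏ j, blaschkeFactor (a j) z‖) discEnd (𝓝 1) := by
  have := tendsto_finsetProd (Finset.univ : Finset (Fin m)) fun j _ =>
    tendsto_norm_blaschkeFactor (ha j)
  simpa [norm_prod] using this

variable {b : ℂ → ℂ}

lemma exists_blaschkeFactor_mul {h : ℂ → ℂ} (hd : DifferentiableOn ℂ h (ball 0 1)) {p : ℂ}
    (hp : ‖p‖ < 1) (h0 : h p = 0) :
    ∃ k, DifferentiableOn ℂ k (ball 0 1) ∧
      ∀ z ∈ ball (0 : ℂ) 1, h z = blaschkeFactor p z * k z := by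
  refine ⟨fun z => (1 - (starRingEnd ℂ) p * z) * dslope h p z, DifferentiableOn.mul (by fun_prop)
    ((Complex.differentiableOn_dslope (isOpen_ball.mem_nhds (by simpa using hp))).2 hd),
    fun z hz => ?_⟩
  have h1 := one_sub_conj_mul_ne_zero hp (mem_ball_zero_iff.1 hz).le
  have h2 := sub_smul_dslope h p z
  rw [h0, sub_zero, smul_eq_mul] at h2
  rw [blaschkeFactor, ← mul_assoc, div_mul_cancel₀ _ h1, h2]

lemma tendsto_norm_quotient
    (ht : Tendsto (fun z => ‖b z‖) discEnd (𝓝 1)) {m : ℕ} {a : Fin m → ℂ} (ha : ∀ j, ‖a j‖ < 1)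
    {h : ℂ → ℂ} (hh : ∀ z ∈ ball (0 : ℂ) 1, b z = (∏ j, blaschkeFactor (a j) z) * h z) :
    Tendsto (fun z => ‖h z‖) discEnd (𝓝 1) := by
  have h1 := ht.div (tendsto_norm_prod_blaschkeFactor ha) one_ne_zero
  rw [div_one] at h1
  refine h1.congr' ?_
  filter_upwards [eventually_mem_ball_discEnd,
    (tendsto_norm_prod_blaschkeFactor ha).eventually_ne one_ne_zero] with z hz hne
  simp only [Pi.div_apply]
  rw [hh z hz, norm_mul, mul_div_cancel_left₀ _ hne]

/-- A proper holomorphic self-map of the disc is a finite Blaschke product times a nonvanishing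
function. -/
lemma exists_nonvanishing_quotient (hd : DifferentiableOn ℂ b (ball 0 1))
    (ht : Tendsto (fun z => ‖b z‖) discEnd (𝓝 1)) :
    ∃ (m : ℕ) (a : Fin m → ℂ) (h : ℂ → ℂ), (∀ j, ‖a j‖ < 1) ∧
      DifferentiableOn ℂ h (ball 0 1) ∧ (∀ z ∈ ball (0 : ℂ) 1, h z ≠ 0) ∧
      ∀ z ∈ ball (0 : ℂ) 1, b z = (∏ j, blaschkeFactor (a j) z) * h z := by
  by_contra! hcon
  have hfac : ∀ m : ℕ, ∃ (a : Fin m → ℂ) (h : ℂ → ℂ), (∀ j, ‖a j‖ < 1) ∧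
      DifferentiableOn ℂ h (ball 0 1) ∧
      ∀ z ∈ ball (0 : ℂ) 1, b z = (∏ j, blaschkeFactor (a j) z) * h z := by
    intro m
    induction m with
    | zero => exact ⟨Fin.elim0, b, fun j => j.elim0, hd, by simp⟩
    | succ m ih =>
      obtain ⟨a, h, ha, hh, hb⟩ := ih
      have : ∃ p ∈ ball (0 : ℂ) 1, h p = 0 := by
        by_contra! hne
        obtain ⟨z, hz, hz'⟩ := hcon m a h ha hh hne
        exact hz' (hb z hz)
      obtain ⟨p, hp, hp0⟩ := this
      rw [mem_ball_zero_iff] at hp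
      obtain ⟨k, hk, hhk⟩ := exists_blaschkeFactor_mul hh hp hp0
      refine ⟨Fin.cons p a, k, Fin.cases hp ha, hk, fun z hz => ?_⟩
      rw [hb z hz, hhk z hz, Fin.prod_univ_succ]
      simp only [Fin.cons_zero, Fin.cons_succ]
      ring
  obtain ⟨ρ, hρ, hzero⟩ := eventually_discEnd.1 (ht.eventually_ne one_ne_zero)
  obtain ⟨z₀, hz₀, hbz₀⟩ :=
    (eventually_mem_ball_discEnd.and (ht.eventually_ne one_ne_zero)).exists
  rw [mem_ball_zero_iff] at hz₀
  set ρ' := max ρ 0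
  have hρ' : ρ' < 1 := max_lt hρ one_pos
  have hδ : 0 < (1 - ρ' ^ 2) * (1 - ‖z₀‖ ^ 2) / 4 := by
    have h1 : 0 < 1 - ρ' ^ 2 := by nlinarith [le_max_right ρ 0]
    have h2 : 0 < 1 - ‖z₀‖ ^ 2 := by nlinarith [norm_nonneg z₀]
    positivity
  obtain ⟨m, hm⟩ := exists_pow_lt_of_lt_one (pow_pos ((norm_nonneg _).lt_of_ne' hbz₀) 2)
    (sub_lt_self 1 hδ)
  obtain ⟨a, h, ha, hh, hb⟩ := hfac m
  have hroot : ∀ j, ‖a j‖ ≤ ρ' := by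
    intro j
    have haj : a j ∈ ball (0 : ℂ) 1 := by simpa using ha j
    have : b (a j) = 0 := by
      rw [hb _ haj, Finset.prod_eq_zero (Finset.mem_univ j) (by simp [blaschkeFactor]), zero_mul]
    by_contra! hlt
    exact hzero _ haj ((le_max_left _ _).trans_lt hlt) (by simp [this])
  have hh1 := norm_le_one_of_tendsto hh (tendsto_norm_quotient ht ha hb) z₀ (by simpa using hz₀)
  have : ‖b z₀‖ ^ 2 ≤ (1 - (1 - ρ' ^ 2) * (1 - ‖z₀‖ ^ 2) / 4) ^ m := by
    rw [hb z₀ (by simpa using hz₀), norm_mul, mul_pow, norm_prod, ← Finset.prod_pow]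
    refine (mul_le_of_le_one_right (Finset.prod_nonneg fun _ _ => sq_nonneg _)
      (pow_le_one₀ (norm_nonneg _) hh1)).trans ?_
    refine (Finset.prod_le_prod (fun _ _ => sq_nonneg _) fun j _ =>
      norm_sq_blaschkeFactor_le (hroot j) hρ' hz₀).trans ?_
    simp
  exact absurd hm (not_lt.2 this)

/-- A proper holomorphic self-map of the unit disc is a finite Blaschke product. -/
theorem exists_eq_blaschke (hd : DifferentiableOn ℂ b (ball 0 1))
    (hmaps : MapsTo b (ball 0 1) (ball 0 1))
    (ht : Tendsto (fun z => ‖b z‖) discEnd (𝓝 1)) :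
    ∃ m : ℕ, 1 ≤ m ∧ ∃ lam : ℂ, ‖lam‖ = 1 ∧ ∃ a : Fin m → ℂ, (∀ j, ‖a j‖ < 1) ∧
      ∀ z ∈ ball (0 : ℂ) 1, b z = lam * ∏ j, blaschkeFactor (a j) z := by
  obtain ⟨m, a, h, ha, hh, hne, hb⟩ := exists_nonvanishing_quotient hd ht
  have hth := tendsto_norm_quotient ht ha hb
  have h1 := norm_le_one_of_tendsto hh hth
  have h2 := norm_le_one_of_tendsto (hh.inv hne) (by simpa [norm_inv] using hth.inv₀ one_ne_zero)
  have h3 : ∀ z ∈ ball (0 : ℂ) 1, ‖h z‖ = 1 := by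
    intro z hz
    refine le_antisymm (h1 z hz) ?_
    have := h2 z hz
    rw [Pi.inv_apply, norm_inv] at this
    exact (inv_le_one₀ (norm_pos_iff.2 (hne z hz))).1 this
  have hconst : ∀ z ∈ ball (0 : ℂ) 1, h z = h 0 := by
    refine Complex.eqOn_of_isPreconnected_of_isMaxOn_norm (convex_ball 0 1).isPreconnected
      isOpen_ball hh (mem_ball_self one_pos) fun z hz => ?_
    simp [h3 z hz, h3 0 (mem_ball_self one_pos)]
  refine ⟨m, ?_, h 0, h3 0 (mem_ball_self one_pos), a, ha, fun z hz => ?_⟩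
  · rw [Nat.one_le_iff_ne_zero]
    rintro rfl
    have h4 := hb 0 (mem_ball_self one_pos)
    have h5 := mem_ball_zero_iff.1 (hmaps (mem_ball_self one_pos))
    rw [h4] at h5
    simp [h3 0 (mem_ball_self one_pos)] at h5
  · rw [hb z hz, hconst z hz, mul_comm]

end Blaschke

section SelfMaps

variable {d : ℕ} {f : (Fin d → ℂ) → (Fin d → ℂ)}

lemma symmMap_mem_symPolydisc {z : Fin d → ℂ} (hz : z ∈ polydisc d) :
    symmMap d z ∈ symPolydisc d := mem_image_of_mem _ hz

/-- Proper holomorphic self-maps of the symmetrized polydisc are induced by proper holomorphic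
self-maps of the disc. -/
theorem exists_inducing_of_proper (hd : 1 ≤ d) (hf : DifferentiableOn ℂ f (symPolydisc d))
    (hfm : MapsTo f (symPolydisc d) (symPolydisc d))
    (hprop : ∀ K : Set (Fin d → ℂ), K ⊆ symPolydisc d → IsCompact K →
        IsCompact (symPolydisc d ∩ f ⁻¹' K)) :
    ∃ c : ℂ → ℂ, DifferentiableOn ℂ c (ball 0 1) ∧ MapsTo c (ball 0 1) (ball 0 1) ∧
      Tendsto (fun z => ‖c z‖) discEnd (𝓝 1) ∧
      ∀ z ∈ polydisc d, f (symmMap d z) = symmMap d fun i => c (z i) := by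
  have hlift : ∀ z ∈ polydisc d, ∃ z' ∈ polydisc d, symmMap d z' = f (symmMap d z) :=
    fun z hz => hfm (symmMap_mem_symPolydisc hz)
  have hQ : ProperRootFamily d d fun z => rootPoly (f (symmMap d z)) := by
    refine ⟨fun z hz => ?_, fun z hz => ?_, fun k => ?_, fun z hz β hβ => ?_, fun z _ σ => ?_,
      fun r hr => ?_⟩
    · obtain ⟨z', -, h⟩ := hlift z hz
      rw [← h, rootPoly_symmMap]
      exact monic_prod_X_sub_C _ _
    · obtain ⟨z', -, h⟩ := hlift z hz
      rw [← h, rootPoly_symmMap]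
      simp
    · have hcomp : DifferentiableOn ℂ (fun z => f (symmMap d z)) (polydisc d) :=
        hf.comp (differentiable_symmMap d).differentiableOn fun z hz => symmMap_mem_symPolydisc hz
      have hi := differentiableOn_pi.1 hcomp
      simp_rw [coeff_rootPoly]
      exact (DifferentiableOn.fun_sum fun i _ => (hi i).mul_const _).const_add _
    · obtain ⟨z', hz', h⟩ := hlift z hz
      rw [← h, rootPoly_symmMap, isRoot_prod_X_sub_C] at hβ
      obtain ⟨i, rfl⟩ := hβ
      exact mem_polydisc.1 hz' i
    · simp only [symmMap_comp_perm]
    · have hKG : symmMap d '' {z | ∀ i, ‖z i‖ ≤ r} ⊆ symPolydisc d :=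
        image_mono fun z hz => mem_polydisc.2 fun i => (hz i).trans_lt hr
      obtain ⟨ρ, -, hρ, hρK⟩ := exists_radius_of_isCompact
        (hprop _ hKG (isCompact_symmMap_closedPolydisc d r)) inter_subset_left
      refine ⟨ρ, hρ, fun z hz ⟨i, hi⟩ => ?_⟩
      obtain ⟨z', hz', h⟩ := hlift z hz
      by_contra! hcon
      refine hi.not_ge (hρK z ⟨symmMap_mem_symPolydisc hz, z', fun j => ?_, h⟩ i)
      refine hcon _ ?_
      rw [← h, rootPoly_symmMap, isRoot_prod_X_sub_C]
      exact ⟨j, rfl⟩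
  obtain ⟨c, hcd, hcm, hct, hc⟩ := hQ.exists_eq_prod ⟨0, hd⟩
  refine ⟨c, hcd, hcm, tendsto_norm_of_forall_lt hcm hct, fun z hz => rootPoly_injective d ?_⟩
  rw [hc z hz, rootPoly_symmMap]

/-- Proper self-maps of the disc induce proper self-maps of the symmetrized polydisc. -/
theorem isCompact_preimage_of_inducing {b : ℂ → ℂ} (hb : ContinuousOn b (ball 0 1))
    (hbt : Tendsto (fun z => ‖b z‖) discEnd (𝓝 1))
    (hfb : ∀ z ∈ polydisc d, f (symmMap d z) = symmMap d fun i => b (z i))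
    {K : Set (Fin d → ℂ)} (hKG : K ⊆ symPolydisc d) (hK : IsCompact K) :
    IsCompact (symPolydisc d ∩ f ⁻¹' K) := by
  obtain ⟨r, -, hr, hrK⟩ := exists_radius_of_isCompact hK hKG
  obtain ⟨ρ, hρ, hρr⟩ := eventually_discEnd.1 (hbt.eventually_const_lt hr)
  have hmem : ∀ z : Fin d → ℂ, (∀ i, ‖z i‖ ≤ ρ) → z ∈ polydisc d := fun z hz =>
    mem_polydisc.2 fun i => (hz i).trans_lt hρ
  have heq : symPolydisc d ∩ f ⁻¹' K =
      symmMap d '' ({z | ∀ i, ‖z i‖ ≤ ρ} ∩ (fun z i => b (z i)) ⁻¹' (symmMap d ⁻¹' K)) := by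
    ext w
    constructor
    · rintro ⟨⟨z, hz, rfl⟩, hw⟩
      rw [mem_preimage, hfb z hz] at hw
      refine ⟨z, ⟨fun i => ?_, hw⟩, rfl⟩
      by_contra! hlt
      exact (hρr (z i) (hz i) hlt).not_ge (hrK _ hw i)
    · rintro ⟨z, ⟨hz, hw⟩, rfl⟩
      refine ⟨symmMap_mem_symPolydisc (hmem z hz), ?_⟩
      rw [mem_preimage, hfb z (hmem z hz)]
      exact hw
  have hcl : {z : Fin d → ℂ | ∀ i, ‖z i‖ ≤ ρ} = univ.pi fun _ => closedBall 0 ρ := by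
    ext z
    simp [Set.mem_pi]
  have hcomp : IsCompact {z : Fin d → ℂ | ∀ i, ‖z i‖ ≤ ρ} := by
    rw [hcl]
    exact isCompact_univ_pi fun _ => isCompact_closedBall 0 ρ
  rw [heq]
  refine IsCompact.image ?_ (continuous_symmMap d)
  refine hcomp.of_isClosed_subset ?_ inter_subset_left
  refine ContinuousOn.preimage_isClosed_of_isClosed ?_ hcomp.isClosed
    (hK.isClosed.preimage (continuous_symmMap d))
  exact continuousOn_pi.2 fun i => hb.comp (continuous_apply i).continuousOn fun z hz =>
    hmem z hz i

lemma isCompact_preimage_of_inverse {g : (Fin d → ℂ) → (Fin d → ℂ)}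
    (hg : ContinuousOn g (symPolydisc d)) (hgm : MapsTo g (symPolydisc d) (symPolydisc d))
    (hgf : ∀ w ∈ symPolydisc d, g (f w) = w) (hfg : ∀ w ∈ symPolydisc d, f (g w) = w)
    {K : Set (Fin d → ℂ)} (hKG : K ⊆ symPolydisc d) (hK : IsCompact K) :
    IsCompact (symPolydisc d ∩ f ⁻¹' K) := by
  convert hK.image_of_continuousOn (hg.mono hKG) using 1
  ext w
  constructor
  · rintro ⟨hw, hfw⟩
    exact ⟨f w, hfw, hgf w hw⟩
  · rintro ⟨v, hv, rfl⟩
    refine ⟨hgm (hKG hv), ?_⟩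
    rwa [mem_preimage, hfg v (hKG hv)]

lemma eq_of_inducing_inverse (hd : 1 ≤ d) {g : (Fin d → ℂ) → (Fin d → ℂ)}
    (hgf : ∀ w ∈ symPolydisc d, g (f w) = w) {b c : ℂ → ℂ}
    (hbm : MapsTo b (ball 0 1) (ball 0 1))
    (hfb : ∀ z ∈ polydisc d, f (symmMap d z) = symmMap d fun i => b (z i))
    (hgc : ∀ z ∈ polydisc d, g (symmMap d z) = symmMap d fun i => c (z i)) :
    ∀ ζ ∈ ball (0 : ℂ) 1, c (b ζ) = ζ := by
  intro ζ hζ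
  have hz : (fun _ => ζ) ∈ polydisc d := fun _ => hζ
  have h := hgf _ (symmMap_mem_symPolydisc hz)
  rw [hfb _ hz, hgc _ fun i => hbm (hz i)] at h
  obtain ⟨-, h⟩ := exists_eq_of_symmMap_eq h ⟨0, hd⟩
  exact h.symm

end SelfMaps

section Automorphisms

variable {φ : ℂ → ℂ}

lemma tendsto_norm_of_bijOn (hφ : DifferentiableOn ℂ φ (ball 0 1))
    (hbij : BijOn φ (ball 0 1) (ball 0 1)) :
    Tendsto (fun z => ‖φ z‖) discEnd (𝓝 1) := by
  refine tendsto_norm_of_forall_lt hbij.mapsTo fun r hr => ?_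
  have hopen : ∀ s ⊆ ball (0 : ℂ) 1, IsOpen s → IsOpen (φ '' s) := by
    refine ((hφ.analyticOnNhd isOpen_ball).is_constant_or_isOpen
      (convex_ball 0 1).isPreconnected).resolve_left ?_
    rintro ⟨w, hw⟩
    have h1 : (2⁻¹ : ℂ) ∈ ball (0 : ℂ) 1 := by norm_num
    have := hbij.injOn h1 (mem_ball_self one_pos) (by rw [hw _ h1, hw _ (mem_ball_self one_pos)])
    norm_num at this
  have hsub : ∀ ρ : Iio (1 : ℝ), ball (0 : ℂ) ρ ⊆ ball 0 1 := fun ρ => ball_subset_ball ρ.2.le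
  have : Nonempty (Iio (1 : ℝ)) := ⟨⟨0, mem_Iio.2 one_pos⟩⟩
  obtain ⟨ρ, hρ⟩ := (isCompact_closedBall (0 : ℂ) r).elim_directed_cover
    (fun ρ : Iio (1 : ℝ) => φ '' ball (0 : ℂ) ρ) (fun ρ => hopen _ (hsub ρ) isOpen_ball) (by
      intro w hw
      obtain ⟨z, hz, rfl⟩ := hbij.surjOn (closedBall_subset_ball hr hw)
      obtain ⟨ρ, h1, h2⟩ := exists_between (mem_ball_zero_iff.1 hz)
      exact mem_iUnion.2 ⟨⟨ρ, h2⟩, z, mem_ball_zero_iff.2 h1, rfl⟩)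
    (Monotone.directed_le fun ρ ρ' h => image_mono (ball_subset_ball h))
  refine ⟨ρ, ρ.2, fun ζ hζ hlt => ?_⟩
  by_contra! hle
  obtain ⟨z, hz, hzζ⟩ := hρ (mem_closedBall_zero_iff.2 hle)
  have := hbij.injOn (hsub ρ hz) hζ hzζ
  subst this
  exact hlt.not_gt (mem_ball_zero_iff.1 hz)

lemma exists_blaschkeFactor_eq {a w : ℂ} (ha : ‖a‖ < 1) (hw : ‖w‖ < 1) :
    ∃ z ∈ ball (0 : ℂ) 1, blaschkeFactor a z = w := by
  refine ⟨blaschkeFactor (-a) w, ?_, ?_⟩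
  · exact mem_ball_zero_iff.2 (norm_blaschkeFactor_lt_one (by simpa using ha) hw)
  · have h1 : 1 + (starRingEnd ℂ) a * w ≠ 0 := by
      simpa using one_sub_conj_mul_ne_zero (a := -a) (by simpa using ha) hw.le
    have h2 := one_sub_conj_mul_ne_zero ha ha.le
    have h3 : blaschkeFactor (-a) w = (w + a) / (1 + (starRingEnd ℂ) a * w) := by
      simp [blaschkeFactor]
    have h4 : 1 - (starRingEnd ℂ) a * ((w + a) / (1 + (starRingEnd ℂ) a * w))
        = (1 - (starRingEnd ℂ) a * a) / (1 + (starRingEnd ℂ) a * w) := by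
      field_simp
      ring
    rw [h3, blaschkeFactor, h4, div_eq_iff (div_ne_zero h2 h1), div_sub' h1,
      mul_div_assoc']
    congr 1
    ring

/-- A holomorphic bijection of the disc is a rotation of a single Blaschke factor. -/
lemma exists_eq_blaschkeFactor_of_bijOn (hφ : DifferentiableOn ℂ φ (ball 0 1))
    (hbij : BijOn φ (ball 0 1) (ball 0 1)) :
    ∃ lam a : ℂ, ‖lam‖ = 1 ∧ ‖a‖ < 1 ∧
      ∀ z ∈ ball (0 : ℂ) 1, φ z = lam * blaschkeFactor a z := by
  obtain ⟨m, hm, lam, hlam, a, ha, hb⟩ :=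
    exists_eq_blaschke hφ hbij.mapsTo (tendsto_norm_of_bijOn hφ hbij)
  have hmem : ∀ j, a j ∈ ball (0 : ℂ) 1 := fun j => by simpa using ha j
  have hzero : ∀ j, φ (a j) = 0 := fun j => by
    rw [hb _ (hmem j), Finset.prod_eq_zero (Finset.mem_univ j) (by simp [blaschkeFactor]), mul_zero]
  set p := a ⟨0, hm⟩
  have hap : ∀ j, a j = p := fun j =>
    hbij.injOn (hmem j) (hmem _) (by rw [hzero, hzero])
  have hpow : ∀ z ∈ ball (0 : ℂ) 1, φ z = lam * blaschkeFactor p z ^ m := fun z hz => by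
    simp [hb z hz, hap]
  have hm1 : m = 1 := by
    by_contra hne
    have hprim := Complex.isPrimitiveRoot_exp m (by omega)
    set ζ := Complex.exp (2 * Real.pi * I / m)
    have hζ : ‖ζ‖ = 1 := hprim.norm'_eq_one (by omega)
    obtain ⟨x, hx, hx'⟩ := exists_blaschkeFactor_eq (ha ⟨0, hm⟩) (w := 2⁻¹) (by norm_num)
    obtain ⟨y, hy, hy'⟩ := exists_blaschkeFactor_eq (ha ⟨0, hm⟩) (w := ζ * 2⁻¹)
      (by rw [norm_mul, hζ]; norm_num)
    have hxy : x = y := hbij.injOn hx hy (by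
      rw [hpow x hx, hpow y hy, hx', hy', mul_pow, hprim.pow_eq_one, one_mul])
    rw [hxy, hy'] at hx'
    refine hprim.ne_one (by omega) ?_
    simpa using hx'
  subst hm1
  exact ⟨lam, p, hlam, ha _, fun z hz => by simpa using hpow z hz⟩

/-- The inverse of a holomorphic bijection of the disc is a Möbius transformation. -/
lemma exists_moebius_inverse (hφ : DifferentiableOn ℂ φ (ball 0 1))
    (hbij : BijOn φ (ball 0 1) (ball 0 1)) :
    ∃ α β γ δ : ℂ, ∀ z ∈ ball (0 : ℂ) 1, γ * φ z + δ ≠ 0 ∧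
      α * φ z + β = z * (γ * φ z + δ) := by
  obtain ⟨lam, a, hlam, ha, h⟩ := exists_eq_blaschkeFactor_of_bijOn hφ hbij
  refine ⟨1, lam * a, (starRingEnd ℂ) a, lam, fun z hz => ?_⟩
  have hl : lam ≠ 0 := by
    rintro rfl
    simp at hlam
  have h1 := one_sub_conj_mul_ne_zero ha (mem_ball_zero_iff.1 hz).le
  have h2 := one_sub_conj_mul_ne_zero ha ha.le
  have h3 : (starRingEnd ℂ) a * φ z + lam
      = lam * (1 - (starRingEnd ℂ) a * a) / (1 - (starRingEnd ℂ) a * z) := by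
    rw [h z hz, blaschkeFactor]
    field_simp
    ring
  refine ⟨h3 ▸ div_ne_zero (mul_ne_zero hl h2) h1, ?_⟩
  rw [h3, h z hz, blaschkeFactor, one_mul, mul_div_assoc', mul_div_assoc', div_add' _ _ _ h1]
  congr 1
  ring

/-- The map `s(ω) ↦ s(ψ(ω))` induced by the Möbius transformation
`ψ(ω) = (α ω + β) / (γ ω + δ)`. -/
def moebiusInduced (d : ℕ) (α β γ δ : ℂ) (w : Fin d → ℂ) : Fin d → ℂ := fun k =>
  (-1) ^ ((k : ℕ) + 1) *
      (homForm w (C δ * X - C β) (C α - C γ * X) : ℂ[X]).coeff (d - (k + 1)) /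
    homForm w δ (-γ)

variable {d : ℕ} {α β γ δ : ℂ}

lemma homForm_symmMap_eq_prod (w : Fin d → ℂ) :
    homForm (symmMap d w) δ (-γ) = ∏ i, (γ * w i + δ) := by
  rw [homForm_symmMap]
  refine Finset.prod_congr rfl fun i _ => ?_
  rw [Algebra.algebraMap_self, RingHom.id_apply]
  ring

lemma moebiusInduced_symmMap {u w : Fin d → ℂ} (hne : ∀ i, γ * w i + δ ≠ 0)
    (heq : ∀ i, α * w i + β = u i * (γ * w i + δ)) :
    moebiusInduced d α β γ δ (symmMap d w) = symmMap d u := by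
  have h : (homForm (symmMap d w) (C δ * X - C β) (C α - C γ * X) : ℂ[X])
      = C (∏ i, (γ * w i + δ)) * rootPoly (symmMap d u) := by
    rw [homForm_symmMap, rootPoly_symmMap, map_prod, ← Finset.prod_mul_distrib]
    refine Finset.prod_congr rfl fun i _ => ?_
    rw [Polynomial.algebraMap_apply, Algebra.algebraMap_self, RingHom.id_apply]
    have := congrArg (C : ℂ → ℂ[X]) (heq i)
    simp only [map_add, map_mul] at this ⊢
    linear_combination -this
  have hD : ∏ i, (γ * w i + δ) ≠ 0 := Finset.prod_ne_zero_iff.2 fun i _ => hne i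
  ext k
  rw [moebiusInduced, h, homForm_symmMap_eq_prod, coeff_C_mul, coeff_rootPoly_sub,
    div_eq_iff hD]
  have : ((-1 : ℂ) ^ ((k : ℕ) + 1)) * (-1) ^ ((k : ℕ) + 1) = 1 := by
    rw [← mul_pow]
    simp
  linear_combination (symmMap d u k * ∏ i, (γ * w i + δ)) * this

lemma differentiableOn_moebiusInduced {U : Set (Fin d → ℂ)}
    (hU : ∀ w ∈ U, homForm w δ (-γ) ≠ 0) :
    DifferentiableOn ℂ (moebiusInduced d α β γ δ) U := by
  refine differentiableOn_pi.2 fun k => differentiableOn_quotient ?_ ?_ hU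
  · simp only [homForm, coeff_add, finsetSum_coeff, Polynomial.algebraMap_apply,
      Algebra.algebraMap_self, RingHom.id_apply, coeff_C_mul]
    fun_prop
  · simp only [homForm, Algebra.algebraMap_self, RingHom.id_apply]
    fun_prop

/-- A holomorphic bijection of the disc induces a biholomorphism of the symmetrized polydisc. -/
theorem exists_inverse_of_inducing {f : (Fin d → ℂ) → (Fin d → ℂ)}
    (hφ : DifferentiableOn ℂ φ (ball 0 1)) (hbij : BijOn φ (ball 0 1) (ball 0 1))
    (hfφ : ∀ z ∈ polydisc d, f (symmMap d z) = symmMap d fun i => φ (z i)) :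
    ∃ g : (Fin d → ℂ) → (Fin d → ℂ), DifferentiableOn ℂ g (symPolydisc d) ∧
      MapsTo g (symPolydisc d) (symPolydisc d) ∧
      (∀ w ∈ symPolydisc d, g (f w) = w) ∧ ∀ w ∈ symPolydisc d, f (g w) = w := by
  obtain ⟨α, β, γ, δ, h⟩ := exists_moebius_inverse hφ hbij
  have hsurj : ∀ w ∈ symPolydisc d, ∃ u ∈ polydisc d, w = symmMap d fun i => φ (u i) := by
    rintro w ⟨z, hz, rfl⟩
    choose u hu huz using fun i => hbij.surjOn (hz i)
    exact ⟨u, hu, by simp only [huz]⟩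
  have hg : ∀ u ∈ polydisc d,
      moebiusInduced d α β γ δ (symmMap d fun i => φ (u i)) = symmMap d u := fun u hu =>
    moebiusInduced_symmMap (fun i => (h _ (hu i)).1) fun i => (h _ (hu i)).2
  refine ⟨moebiusInduced d α β γ δ, differentiableOn_moebiusInduced fun w hw => ?_,
    fun w hw => ?_, fun w hw => ?_, fun w hw => ?_⟩
  · obtain ⟨u, hu, rfl⟩ := hsurj w hw
    rw [homForm_symmMap_eq_prod]
    exact Finset.prod_ne_zero_iff.2 fun i _ => (h _ (hu i)).1
  · obtain ⟨u, hu, rfl⟩ := hsurj w hw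
    rw [hg u hu]
    exact symmMap_mem_symPolydisc hu
  · obtain ⟨u, hu, rfl⟩ := hw
    rw [hfφ u hu, hg u hu]
  · obtain ⟨u, hu, rfl⟩ := hsurj w hw
    rw [hg u hu, hfφ u hu]

end Automorphisms

end SymmetrizedPolydisc

/-- Edigarian–Zwonek: a holomorphic self-map `f` of `G_d` is proper iff
`f∘s = s∘(B,…,B)` on `𝔻^d` for some finite Blaschke product `B`; and `f` is a
biholomorphism of `G_d` iff `f∘s = s∘(φ,…,φ)` on `𝔻^d` for some holomorphic bijection
`φ : 𝔻 → 𝔻`. -/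
theorem stmt12 (d : ℕ) (hd : 1 ≤ d) (f : (Fin d → ℂ) → (Fin d → ℂ))
    (hf : DifferentiableOn ℂ f (symPolydisc d))
    (hfm : Set.MapsTo f (symPolydisc d) (symPolydisc d)) :
    -- `f` is proper iff it comes from a finite Blaschke product
    ((∀ K : Set (Fin d → ℂ), K ⊆ symPolydisc d → IsCompact K →
        IsCompact (symPolydisc d ∩ f ⁻¹' K))
      ↔ ∃ (m : ℕ), 1 ≤ m ∧ ∃ (lam : ℂ), ‖lam‖ = 1 ∧ ∃ a : Fin m → ℂ,
          (∀ j, ‖a j‖ < 1) ∧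
          ∀ z ∈ polydisc d,
            f (symmMap d z)
              = symmMap d (fun i =>
                  lam * ∏ j, (z i - a j) / (1 - (starRingEnd ℂ) (a j) * z i)))
    ∧
    -- `f` is a biholomorphism of `G_d` iff it comes from a holomorphic automorphism of `𝔻`
    ((∃ g : (Fin d → ℂ) → (Fin d → ℂ), DifferentiableOn ℂ g (symPolydisc d) ∧
        Set.MapsTo g (symPolydisc d) (symPolydisc d) ∧
        (∀ w ∈ symPolydisc d, g (f w) = w) ∧ (∀ w ∈ symPolydisc d, f (g w) = w))
      ↔ ∃ φ : ℂ → ℂ, DifferentiableOn ℂ φ (ball (0 : ℂ) 1) ∧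
          Set.BijOn φ (ball (0 : ℂ) 1) (ball (0 : ℂ) 1) ∧
          ∀ z ∈ polydisc d,
            f (symmMap d z) = symmMap d (fun i => φ (z i))) := by
  refine ⟨⟨fun hprop => ?_, ?_⟩, ⟨?_, ?_⟩⟩
  · obtain ⟨c, hcd, hcm, hct, hc⟩ := exists_inducing_of_proper hd hf hfm hprop
    obtain ⟨m, hm, lam, hlam, a, ha, hb⟩ := exists_eq_blaschke hcd hcm hct
    refine ⟨m, hm, lam, hlam, a, ha, fun z hz => ?_⟩
    rw [hc z hz]
    exact congrArg _ (funext fun i => hb _ (hz i))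
  · rintro ⟨m, -, lam, hlam, a, ha, hb⟩ K hKG hK
    refine isCompact_preimage_of_inducing (b := fun z => lam * ∏ j, blaschkeFactor (a j) z)
      ?_ ?_ hb hKG hK
    · exact ((differentiableOn_finset_prod _ fun j _ =>
        differentiableOn_blaschkeFactor (ha j)).const_mul lam).continuousOn
    · simpa [norm_mul, hlam] using tendsto_norm_prod_blaschkeFactor ha
  · rintro ⟨g, hg, hgm, hgf, hfg⟩
    obtain ⟨b, hbd, hbm, -, hb⟩ := exists_inducing_of_proper hd hf hfm fun K hKG hK =>
      isCompact_preimage_of_inverse hg.continuousOn hgm hgf hfg hKG hK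
    obtain ⟨c, -, hcm, -, hc⟩ := exists_inducing_of_proper hd hg hgm fun K hKG hK =>
      isCompact_preimage_of_inverse hf.continuousOn hfm hfg hgf hKG hK
    have hcb := eq_of_inducing_inverse hd hgf hbm hb hc
    have hbc := eq_of_inducing_inverse hd hfg hcm hc hb
    exact ⟨b, hbd, InvOn.bijOn ⟨hcb, hbc⟩ hbm hcm, hb⟩
  · rintro ⟨φ, hφ, hbij, hfφ⟩
    exact exists_inverse_of_inducing hφ hbij hfφ
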